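/- arXiv:2404.02246 — 3 statements merged into one kernel-verified Lean document; each statement's English description precedes it below -/
import Mathlib

section
/- Let W be a d×d matrix weight on ℝ^n and let 1 < t, s < ∞. Then there exist constants c₁, c₂ > 0 depending only on d, t, s such that max([W]_{A_t}, [W]_{RH_{t,s}})^s ≤ c₁·[W^s]_{A_{t,st}} and [W^s]_{A_{t,st}} ≤ c₂·([W]_{A_t}·[W]_{RH_{t,s}})^s. In particular, [W]_{A_t} < ∞ and [W]_{RH_{t,s}} < ∞ if and only if [W^s]_{A_{t,st}} < ∞. -/
open MeasureTheory ENNReal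
open scoped ComplexOrder

noncomputable section

/-- The power `A^a` of a matrix, defined via the continuous functional calculus
(for positive definite Hermitian matrices this diagonalizes `A` and raises the
eigenvalues to the `a`-th power). -/
def matRpow {d : ℕ} (A : Matrix (Fin d) (Fin d) ℂ) (a : ℝ) : Matrix (Fin d) (Fin d) ℂ :=
  cfc (fun x : ℝ => x ^ a) A

/-- The spectral norm (largest singular value) of a matrix, i.e. its norm as an operator
on the Euclidean space `ℂ^d`. -/
def specNorm {d : ℕ} (A : Matrix (Fin d) (Fin d) ℂ) : ℝ :=
  ‖Matrix.toEuclideanCLM (𝕜 := ℂ) A‖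

/-- Hölder conjugate exponent. -/
def conjExp (p : ℝ) : ℝ := p / (p - 1)

/-- The Lebesgue average `⨍_Q f dμ` of an `ℝ≥0∞`-valued function. -/
def lavg {α : Type*} [MeasurableSpace α] (μ : Measure α) (Q : Set α) (f : α → ℝ≥0∞) : ℝ≥0∞ :=
  (μ Q)⁻¹ * ∫⁻ x in Q, f x ∂μ

/-- The two-exponent matrix Muckenhoupt characteristic `[W]_{A_{p,q}}`, with the supremum
taken over a family `S` of sets. -/
def matApq {α : Type*} [MeasurableSpace α] {d : ℕ} (μ : Measure α) (S : Set (Set α))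
    (W : α → Matrix (Fin d) (Fin d) ℂ) (p q : ℝ) : ℝ≥0∞ :=
  ⨆ Q ∈ S, lavg μ Q fun x =>
    (lavg μ Q fun y =>
        ENNReal.ofReal (specNorm (matRpow (W x) (1 / q) * matRpow (W y) (-(1 / q))))
          ^ conjExp p) ^ (q / conjExp p)

/-- The endpoint matrix Muckenhoupt characteristic `[W]_{A_{t,∞}}`, with the supremum
taken over a family `S` of sets. -/
def matAtInfty {α : Type*} [MeasurableSpace α] {d : ℕ} (μ : Measure α) (S : Set (Set α))
    (W : α → Matrix (Fin d) (Fin d) ℂ) (t : ℝ) : ℝ≥0∞ :=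
  ⨆ Q ∈ S, essSup (fun x =>
    lavg μ Q fun y =>
      ENNReal.ofReal (specNorm (matRpow (W x) (1 / t) * matRpow (W y) (-(1 / t)))) ^ t)
    (μ.restrict Q)

/-- The scalar reverse Hölder characteristic `[w]_{RH_s}`, with the supremum taken over a
family `S` of sets. -/
def scalRH {α : Type*} [MeasurableSpace α] (μ : Measure α) (S : Set (Set α))
    (w : α → ℝ) (s : ℝ) : ℝ≥0∞ :=
  ⨆ Q ∈ S, (lavg μ Q fun x => ENNReal.ofReal (w x) ^ s) ^ (1 / s) /
    lavg μ Q fun x => ENNReal.ofReal (w x)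

/-- The scalar reverse Hölder characteristic `[w]_{RH_∞}`, with the supremum taken over a
family `S` of sets. -/
def scalRHInfty {α : Type*} [MeasurableSpace α] (μ : Measure α) (S : Set (Set α))
    (w : α → ℝ) : ℝ≥0∞ :=
  ⨆ Q ∈ S, essSup (fun x => ENNReal.ofReal (w x)) (μ.restrict Q) /
    lavg μ Q fun x => ENNReal.ofReal (w x)

/-- The matrix reverse Hölder characteristic `[W]_{RH_{t,s}}`. -/
def matRH {α : Type*} [MeasurableSpace α] {d : ℕ} (μ : Measure α) (S : Set (Set α))
    (W : α → Matrix (Fin d) (Fin d) ℂ) (t s : ℝ) : ℝ≥0∞ :=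
  ⨆ (e : EuclideanSpace ℂ (Fin d)) (_ : e ≠ 0),
    scalRH μ S (fun x => ‖Matrix.toEuclideanCLM (𝕜 := ℂ) (matRpow (W x) (1 / t)) e‖ ^ t) s

/-- The matrix reverse Hölder characteristic `[W]_{RH_{t,∞}}`. -/
def matRHInfty {α : Type*} [MeasurableSpace α] {d : ℕ} (μ : Measure α) (S : Set (Set α))
    (W : α → Matrix (Fin d) (Fin d) ℂ) (t : ℝ) : ℝ≥0∞ :=
  ⨆ (e : EuclideanSpace ℂ (Fin d)) (_ : e ≠ 0),
    scalRHInfty μ S (fun x => ‖Matrix.toEuclideanCLM (𝕜 := ℂ) (matRpow (W x) (1 / t)) e‖ ^ t)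

/-- An axis-parallel cube in `ℝ^n` with corner `c` and positive side length `h`. -/
def cube {n : ℕ} (c : Fin n → ℝ) (h : ℝ) : Set (Fin n → ℝ) :=
  {x | ∀ i, x i ∈ Set.Ico (c i) (c i + h)}

/-- The family of all axis-parallel cubes in `ℝ^n`. -/
def cubes (n : ℕ) : Set (Set (Fin n → ℝ)) :=
  {Q | ∃ (c : Fin n → ℝ) (h : ℝ), 0 < h ∧ Q = cube c h}

/-- The family of all (left-closed right-open, nontrivial, bounded) intervals in `ℝ`,
i.e. the axis-parallel "cubes" of `ℝ^1`. -/
def intervalsR : Set (Set ℝ) := {I | ∃ a b : ℝ, a < b ∧ I = Set.Ico a b}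

/-- The family of all dyadic intervals `[m·2^k, (m+1)·2^k)`, `m, k ∈ ℤ`, in `ℝ`. -/
def dyadicsR : Set (Set ℝ) :=
  {I | ∃ m k : ℤ, I = Set.Ico ((m : ℝ) * 2 ^ k) (((m : ℝ) + 1) * 2 ^ k)}

/-- A `d×d` matrix weight: a locally integrable matrix-valued function whose values are
a.e. positive definite (Hermitian). -/
def IsMatrixWeight {α : Type*} [MeasurableSpace α] [TopologicalSpace α] {d : ℕ}
    (μ : Measure α) (W : α → Matrix (Fin d) (Fin d) ℂ) : Prop :=
  (∀ i j, LocallyIntegrable (fun x => W x i j) μ) ∧ ∀ᵐ x ∂μ, (W x).PosDef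

open scoped MatrixOrder in
theorem spectrum_pos_of_posDef {d : ℕ} {A : Matrix (Fin d) (Fin d) ℂ} (hA : A.PosDef) {x : ℝ}
    (hx : x ∈ spectrum ℝ A) : 0 < x :=
  hA.isStrictlyPositive.spectrum_pos hx

open Topology in
open scoped Matrix.Norms.L2Operator in
theorem continuousOn_matRpow (d : ℕ) (a : ℝ) :
    ContinuousOn (fun A : Matrix (Fin d) (Fin d) ℂ => matRpow A a) {A | A.PosDef} := by
  unfold matRpow
  refine ContinuousOn.cfc_of_mem_nhdsSet (s := Set.Ioi 0) (fun x : ℝ => x ^ a) ?_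
    continuousOn_id (fun A hA => hA.isHermitian) ?_
  · rw [isOpen_Ioi.mem_nhdsSet]
    simp only [Set.iUnion_subset_iff]
    intro A hA x hx
    exact spectrum_pos_of_posDef hA hx
  · exact fun x hx => (Real.continuousAt_rpow_const _ _ (Or.inl (ne_of_gt hx))).continuousWithinAt

theorem matRpow_matRpow {d : ℕ} {A : Matrix (Fin d) (Fin d) ℂ} (hA : A.PosDef) (a b : ℝ) :
    matRpow (matRpow A a) b = matRpow A (a * b) := by
  unfold matRpow
  have hpos : ∀ x ∈ spectrum ℝ A, 0 < x := fun x hx => spectrum_pos_of_posDef hA hx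
  have hA' : IsSelfAdjoint A := hA.isHermitian
  rw [← cfc_comp' (fun x : ℝ => x ^ b) (fun x : ℝ => x ^ a) A ?_ ?_]
  · exact cfc_congr fun x hx => (Real.rpow_mul (hpos x hx).le a b).symm
  · rintro _ ⟨x, hx, rfl⟩
    exact (Real.continuousAt_rpow_const _ _
      (Or.inl (Real.rpow_pos_of_pos (hpos x hx) a).ne')).continuousWithinAt
  · exact fun x hx => (Real.continuousAt_rpow_const _ _
      (Or.inl (hpos x hx).ne')).continuousWithinAt

theorem matRpow_neg_mul_matRpow {d : ℕ} {A : Matrix (Fin d) (Fin d) ℂ} (hA : A.PosDef) (a : ℝ) :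
    matRpow A (-a) * matRpow A a = 1 := by
  unfold matRpow
  have hpos : ∀ x ∈ spectrum ℝ A, 0 < x := fun x hx => spectrum_pos_of_posDef hA hx
  have hA' : IsSelfAdjoint A := hA.isHermitian
  have hc : ∀ c : ℝ, ContinuousOn (fun x : ℝ => x ^ c) (spectrum ℝ A) := fun c x hx =>
    (Real.continuousAt_rpow_const _ _ (Or.inl (hpos x hx).ne')).continuousWithinAt
  rw [← cfc_mul _ _ A (hc _) (hc _), ← cfc_one ℝ A]
  refine cfc_congr fun x hx => ?_
  simp [← Real.rpow_add (hpos x hx)]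

theorem isSelfAdjoint_matRpow {d : ℕ} (A : Matrix (Fin d) (Fin d) ℂ) (a : ℝ) :
    IsSelfAdjoint (matRpow A a) :=
  cfc_predicate _ _

open scoped Matrix.Norms.L2Operator in
theorem specNorm_matRpow_le {d : ℕ} {A : Matrix (Fin d) (Fin d) ℂ} (hA : A.PosDef) {a : ℝ}
    (ha : 0 ≤ a) : specNorm (matRpow A a) ≤ specNorm A ^ a := by
  change ‖matRpow A a‖ ≤ ‖A‖ ^ a
  unfold matRpow
  refine norm_cfc_le (by positivity) fun x hx => ?_
  have hx0 : 0 < x := spectrum_pos_of_posDef hA hx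
  rw [Real.norm_of_nonneg (by positivity)]
  refine Real.rpow_le_rpow hx0.le ?_ ha
  have := spectrum.norm_le_norm_mul_of_mem hx
  rw [Real.norm_of_nonneg hx0.le] at this
  rcases subsingleton_or_nontrivial (Matrix (Fin d) (Fin d) ℂ) with h | h
  · simp [spectrum.of_subsingleton] at hx
  · simpa using this

theorem measurableSet_posDef (d : ℕ) :
    @MeasurableSet _ (borel _) {A : Matrix (Fin d) (Fin d) ℂ | A.PosDef} := by
  borelize (Matrix (Fin d) (Fin d) ℂ)
  have h : {A : Matrix (Fin d) (Fin d) ℂ | A.PosDef} =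
      {A | A.PosSemidef} ∩ {A | A.det ≠ 0} := by
    ext A
    constructor
    · exact fun hA => ⟨hA.posSemidef, hA.det_pos.ne'⟩
    · rintro ⟨h1, h2⟩
      exact h1.posDef_iff_isUnit.2 ((Matrix.isUnit_iff_isUnit_det A).2 (isUnit_iff_ne_zero.2 h2))
  rw [h]
  refine MeasurableSet.inter (IsClosed.measurableSet ?_) (IsOpen.measurableSet ?_)
  · have : {A : Matrix (Fin d) (Fin d) ℂ | A.PosSemidef} =
        {A | A.conjTranspose = A} ∩ ⋂ x : Fin d → ℂ, {A | 0 ≤ star x ⬝ᵥ (A.mulVec x)} := by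
      ext A
      simp [Matrix.posSemidef_iff_dotProduct_mulVec, Matrix.IsHermitian]
    rw [this]
    refine (isClosed_eq (by fun_prop) continuous_id).inter (isClosed_iInter fun x => ?_)
    exact isClosed_le continuous_const (by fun_prop)
  · exact isOpen_ne_fun (by fun_prop) continuous_const

theorem stronglyMeasurable_matRpow {α : Type*} [MeasurableSpace α] {d : ℕ}
    {W : α → Matrix (Fin d) (Fin d) ℂ} (hW : StronglyMeasurable W) (hpos : ∀ x, (W x).PosDef)
    (a : ℝ) : StronglyMeasurable fun x => matRpow (W x) a := by
  have h := continuousOn_iff_continuous_domRestrict.1 (continuousOn_matRpow d a)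
  borelize (Matrix (Fin d) (Fin d) ℂ)
  have : SecondCountableTopology (Matrix (Fin d) (Fin d) ℂ) :=
    inferInstanceAs (SecondCountableTopology (Fin d → Fin d → ℂ))
  have : TopologicalSpace.PseudoMetrizableSpace (Matrix (Fin d) (Fin d) ℂ) :=
    inferInstanceAs (TopologicalSpace.PseudoMetrizableSpace (Fin d → Fin d → ℂ))
  exact (h.measurable.comp (hW.measurable.subtype_mk (h := hpos))).stronglyMeasurable

theorem exists_stronglyMeasurable_posDef {α : Type*} [MeasurableSpace α] {d : ℕ} {μ : Measure α}
    {W : α → Matrix (Fin d) (Fin d) ℂ} (hW : ∀ i j, AEStronglyMeasurable (fun x => W x i j) μ)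
    (hpos : ∀ᵐ x ∂μ, (W x).PosDef) :
    ∃ W' : α → Matrix (Fin d) (Fin d) ℂ,
      StronglyMeasurable W' ∧ (∀ x, (W' x).PosDef) ∧ W =ᵐ[μ] W' := by
  classical
  borelize (Matrix (Fin d) (Fin d) ℂ)
  have : SecondCountableTopology (Matrix (Fin d) (Fin d) ℂ) :=
    inferInstanceAs (SecondCountableTopology (Fin d → Fin d → ℂ))
  have : TopologicalSpace.PseudoMetrizableSpace (Matrix (Fin d) (Fin d) ℂ) :=
    inferInstanceAs (TopologicalSpace.PseudoMetrizableSpace (Fin d → Fin d → ℂ))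
  let M : α → Matrix (Fin d) (Fin d) ℂ := fun x => Matrix.of fun i j => (hW i j).mk _ x
  have hM : Measurable M := by
    have h : Measurable fun x => fun i j => (hW i j).mk _ x :=
      measurable_pi_lambda _ fun i => measurable_pi_lambda _ fun j =>
        (hW i j).stronglyMeasurable_mk.measurable
    have h' : StronglyMeasurable M := h.stronglyMeasurable
    exact h'.measurable
  have hWM : W =ᵐ[μ] M := by
    have : ∀ᵐ x ∂μ, ∀ i j, W x i j = (hW i j).mk _ x :=
      ae_all_iff.2 fun i => ae_all_iff.2 fun j => (hW i j).ae_eq_mk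
    filter_upwards [this] with x hx
    ext i j
    exact hx i j
  refine ⟨fun x => if (M x).PosDef then M x else 1,
    Measurable.stronglyMeasurable ?_, fun x => ?_, ?_⟩
  · exact Measurable.ite (hM (measurableSet_posDef d)) hM measurable_const
  · dsimp only
    split_ifs with h
    · exact h
    · exact Matrix.PosDef.one
  · filter_upwards [hpos, hWM] with x hx hx'
    rw [if_pos (hx' ▸ hx), hx']

theorem exists_basis_enorm_repr_le (G : Type*) [NormedAddCommGroup G] [NormedSpace ℂ G]
    [FiniteDimensional ℂ G] :
    ∃ b : Module.Basis (Fin (Module.finrank ℂ G)) ℂ G,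
      (∀ v i, ‖b.repr v i‖ₑ ≤ ‖v‖ₑ) ∧ ∀ v, ‖v‖ₑ ≤ ∑ i, ‖b.repr v i‖ₑ := by
  classical
  have : ProperSpace G := FiniteDimensional.proper ℂ G
  set r := Module.finrank ℂ G
  let b₀ : Module.Basis (Fin r) ℂ G := Module.finBasis ℂ G
  let K : Set (Fin r → G) := Set.univ.pi fun _ => Metric.closedBall 0 1
  have hK : IsCompact K := isCompact_univ_pi fun _ => isCompact_closedBall 0 1
  have hcont : Continuous fun u : Fin r → G => ‖b₀.det u‖ := by
    have h1 : ∀ i, Continuous fun v : G => b₀.repr v i := fun i =>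
      (b₀.coord i).continuous_of_finiteDimensional
    refine Continuous.norm ?_
    change Continuous fun u : Fin r → G => (b₀.toMatrix u).det
    refine Continuous.matrix_det (continuous_matrix fun i j => ?_)
    simp only [Module.Basis.toMatrix_apply]
    exact (h1 i).comp (continuous_apply j)
  obtain ⟨u, hu, hmax⟩ := hK.exists_isMaxOn ⟨0, by simp [K]⟩ hcont.continuousOn
  have hu1 : ∀ i, ‖u i‖ ≤ 1 := by simpa [K] using hu
  have hdet : b₀.det u ≠ 0 := by
    intro h0
    have hne : ∀ i, (‖b₀ i‖ : ℂ) ≠ 0 := fun i => by simpa using b₀.ne_zero i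
    have hw : (fun i => (‖b₀ i‖ : ℂ)⁻¹ • b₀ i) ∈ K := by
      simp [K, norm_smul, b₀.ne_zero]
    have h1 : ‖b₀.det fun i => (‖b₀ i‖ : ℂ)⁻¹ • b₀ i‖ ≤ ‖b₀.det u‖ := hmax hw
    rw [h0, norm_zero, norm_le_zero_iff] at h1
    have h2 : b₀.det (fun i => (‖b₀ i‖ : ℂ)⁻¹ • b₀ i) = (∏ i, (‖b₀ i‖ : ℂ)⁻¹) • b₀.det b₀ :=
      AlternatingMap.map_smul_univ _ _ _
    rw [h1, b₀.det_self, eq_comm, smul_eq_mul, mul_one, Finset.prod_eq_zero_iff] at h2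
    obtain ⟨i, _, hi⟩ := h2
    exact inv_ne_zero (hne i) hi
  have hunit : IsUnit (b₀.det u) := isUnit_iff_ne_zero.2 hdet
  obtain ⟨hli, hsp⟩ := (b₀.is_basis_iff_det).2 hunit
  let b := Module.Basis.mk hli hsp.ge
  have hb : ∀ i, b i = u i := fun i => by simp [b]
  have hunitball : ∀ v : G, ‖v‖ ≤ 1 → ∀ i, ‖b.repr v i‖ ≤ 1 := by
    intro v hv i
    have hw : Function.update u i v ∈ K := by
      simp only [K, Set.mem_univ_pi, mem_closedBall_zero_iff]
      intro j
      rcases eq_or_ne j i with rfl | hj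
      · simpa using hv
      · simpa [hj] using hu1 j
    have h1 : b₀.det (Function.update u i v) = b.repr v i * b₀.det u := by
      conv_lhs => rw [← b.sum_repr v]
      rw [AlternatingMap.map_update_sum, Finset.sum_eq_single i]
      · rw [AlternatingMap.map_update_smul, hb, Function.update_eq_self, smul_eq_mul]
      · intro j _ hj
        rw [AlternatingMap.map_update_smul, hb, AlternatingMap.map_update_self _ _ hj.symm,
          smul_zero]
      · simp
    have h2 : ‖b₀.det (Function.update u i v)‖ ≤ ‖b₀.det u‖ := hmax hw
    rw [h1, norm_mul] at h2
    exact le_of_mul_le_mul_right (by simpa using h2) (norm_pos_iff.2 hdet)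
  refine ⟨b, fun v i => ?_, fun v => ?_⟩
  swap
  · conv_lhs => rw [← b.sum_repr v]
    refine (enorm_sum_le _ _).trans (Finset.sum_le_sum fun i _ => ?_)
    rw [← ofReal_norm, ← ofReal_norm, norm_smul, hb]
    exact ENNReal.ofReal_le_ofReal (mul_le_of_le_one_right (norm_nonneg _) (hu1 i))
  rw [← ofReal_norm, ← ofReal_norm]
  refine ENNReal.ofReal_le_ofReal ?_
  rcases eq_or_ne v 0 with rfl | hv
  · simp
  have hvn : 0 < ‖v‖ := norm_pos_iff.2 hv
  have := hunitball ((‖v‖ : ℂ)⁻¹ • v) (by simp [norm_smul, hvn.ne']) i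
  simp only [map_smul, Finsupp.smul_apply, norm_smul, norm_inv, Complex.norm_real,
    norm_norm] at this
  rwa [inv_mul_le_iff₀ hvn, mul_one] at this

theorem lintegral_rpow_le_of_isProbabilityMeasure {α : Type*} [MeasurableSpace α] {ν : Measure α}
    [IsProbabilityMeasure ν] {f : α → ℝ≥0∞} (hf : AEMeasurable f ν) {s : ℝ} (hs : 1 < s) :
    (∫⁻ x, f x ∂ν) ^ s ≤ ∫⁻ x, f x ^ s ∂ν := by
  have h := ENNReal.lintegral_mul_le_Lp_mul_Lq ν (Real.HolderConjugate.conjExponent hs) hf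
    (aemeasurable_const (b := 1))
  simp only [Pi.mul_apply, mul_one, ENNReal.one_rpow, lintegral_one, measure_univ] at h
  calc _ ≤ _ := ENNReal.rpow_le_rpow h (by linarith)
    _ = _ := by rw [← ENNReal.rpow_mul, one_div_mul_cancel (by linarith), ENNReal.rpow_one]

theorem enorm_le_sum_enorm_inner {d : ℕ} (x : EuclideanSpace ℂ (Fin d)) :
    ‖x‖ₑ ≤ ∑ j, ‖inner ℂ x (EuclideanSpace.basisFun (Fin d) ℂ j)‖ₑ := by
  set b := EuclideanSpace.basisFun (Fin d) ℂ
  calc ‖x‖ₑ = ‖∑ j, inner ℂ (b j) x • b j‖ₑ := by rw [b.sum_repr' x]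
    _ ≤ ∑ j, ‖inner ℂ (b j) x • b j‖ₑ := enorm_sum_le _ _
    _ = ∑ j, ‖inner ℂ x (b j)‖ₑ := by
      refine Finset.sum_congr rfl fun j _ => ?_
      rw [← ofReal_norm, ← ofReal_norm, norm_smul, b.norm_eq_one, mul_one, norm_inner_symm]

theorem enorm_clm_le_sum_enorm_apply {d : ℕ}
    (B : EuclideanSpace ℂ (Fin d) →L[ℂ] EuclideanSpace ℂ (Fin d)) :
    ‖B‖ₑ ≤ ∑ j, ‖B (EuclideanSpace.basisFun (Fin d) ℂ j)‖ₑ := by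
  set b := EuclideanSpace.basisFun (Fin d) ℂ
  have h : ‖B‖ ≤ ∑ j, ‖B (b j)‖ := by
    refine B.opNorm_le_bound (Finset.sum_nonneg fun _ _ => norm_nonneg _) fun x => ?_
    calc ‖B x‖ = ‖∑ j, inner ℂ (b j) x • B (b j)‖ := by
          conv_lhs => rw [← b.sum_repr' x]
          simp
      _ ≤ ∑ j, ‖inner ℂ (b j) x • B (b j)‖ := norm_sum_le _ _
      _ ≤ ∑ j, ‖B (b j)‖ * ‖x‖ := by
          refine Finset.sum_le_sum fun j _ => ?_
          rw [norm_smul, mul_comm]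
          refine mul_le_mul_of_nonneg_left ?_ (norm_nonneg _)
          simpa [b.norm_eq_one] using norm_inner_le_norm (𝕜 := ℂ) (b j) x
      _ = _ := (Finset.sum_mul ..).symm
  rw [← ofReal_norm]
  refine (ENNReal.ofReal_le_ofReal h).trans (le_of_eq ?_)
  rw [ENNReal.ofReal_sum_of_nonneg fun _ _ => norm_nonneg _]
  simp [ofReal_norm]

theorem exists_reducing_vectors {α : Type*} [MeasurableSpace α] {ν : Measure α} {d : ℕ}
    {p : ℝ≥0∞} [Fact (1 ≤ p)]
    {U : α → EuclideanSpace ℂ (Fin d) →L[ℂ] EuclideanSpace ℂ (Fin d)}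
    (hU : MemLp U p ν) (hsa : ∀ y, IsSelfAdjoint (U y)) :
    ∃ r ≤ d, ∃ v : Fin r → EuclideanSpace ℂ (Fin d),
      ∀ A : EuclideanSpace ℂ (Fin d) →L[ℂ] EuclideanSpace ℂ (Fin d), IsSelfAdjoint A →
        eLpNorm (fun y => A * U y) p ν ≤ d * ∑ i, ‖A (v i)‖ₑ ∧
        ∀ i, ‖A (v i)‖ₑ ≤ d * eLpNorm (fun y => A * U y) p ν := by
  set E := EuclideanSpace ℂ (Fin d)
  have hmem : ∀ w : E, MemLp (fun y => U y w) p ν := fun w =>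
    (ContinuousLinearMap.apply ℂ E w).comp_memLp' hU
  let L : E →ₗ[ℂ] Lp E p ν :=
    { toFun := fun w => (hmem w).toLp _
      map_add' := fun w w' => by
        rw [← MemLp.toLp_add]
        exact MemLp.toLp_congr _ _ (Filter.Eventually.of_forall fun y => map_add _ _ _)
      map_smul' := fun c w => by
        rw [RingHom.id_apply, ← MemLp.toLp_const_smul]
        exact MemLp.toLp_congr _ _ (Filter.Eventually.of_forall fun y => map_smul _ _ _) }
  have hL : ∀ w, ‖L w‖ₑ = eLpNorm (fun y => U y w) p ν := fun w => Lp.enorm_toLp (hf := hmem w)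
  obtain ⟨b, hb1, hb2⟩ := exists_basis_enorm_repr_le (LinearMap.range L)
  let φ : Fin (Module.finrank ℂ (LinearMap.range L)) → E →ₗ[ℂ] ℂ :=
    fun i => b.coord i ∘ₗ L.rangeRestrict
  have hφ1 : ∀ i w, ‖φ i w‖ₑ ≤ eLpNorm (fun y => U y w) p ν := fun i w => by
    rw [← hL]
    exact hb1 (L.rangeRestrict w) i
  have hφ2 : ∀ w, eLpNorm (fun y => U y w) p ν ≤ ∑ i, ‖φ i w‖ₑ := fun w => by
    rw [← hL]
    exact hb2 (L.rangeRestrict w)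
  let v : Fin (Module.finrank ℂ (LinearMap.range L)) → E :=
    fun i => (InnerProductSpace.toDual ℂ E).symm (φ i).toContinuousLinearMap
  have hv : ∀ i w, inner ℂ (v i) w = φ i w := fun i w => by
    simp [v]
  let e := EuclideanSpace.basisFun (Fin d) ℂ
  refine ⟨_, (LinearMap.finrank_range_le L).trans_eq finrank_euclideanSpace_fin, v, fun A hA => ?_⟩
  have hAv : ∀ i w, inner ℂ (A (v i)) w = φ i (A w) := fun i w => by
    rw [← hv, ← ContinuousLinearMap.adjoint_inner_right,
      ContinuousLinearMap.isSelfAdjoint_iff'.1 hA]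
  have hnorm : eLpNorm (fun y => A * U y) p ν = eLpNorm (fun y => U y * A) p ν := by
    refine eLpNorm_congr_norm_ae (Filter.Eventually.of_forall fun y => ?_)
    rw [← norm_star, star_mul, hA.star_eq, (hsa y).star_eq]
  rw [hnorm]
  constructor
  · calc eLpNorm (fun y => U y * A) p ν
        ≤ eLpNorm (fun y => ∑ j, ‖U y (A (e j))‖) p ν := by
          refine eLpNorm_mono_enorm fun y => (enorm_clm_le_sum_enorm_apply _).trans ?_
          rw [Real.enorm_of_nonneg (Finset.sum_nonneg fun _ _ => norm_nonneg _),
            ENNReal.ofReal_sum_of_nonneg fun _ _ => norm_nonneg _]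
          simp [ofReal_norm, e]
      _ ≤ ∑ j, eLpNorm (fun y => ‖U y (A (e j))‖) p ν := by
          have := eLpNorm_sum_le (s := Finset.univ) (μ := ν) (p := p)
            (f := fun j y => ‖U y (A (e j))‖) (fun j _ => (hmem _).1.norm) Fact.out
          convert this using 2
          ext y
          simp
      _ ≤ ∑ j, ∑ i, ‖A (v i)‖ₑ := by
          refine Finset.sum_le_sum fun j _ => ?_
          rw [eLpNorm_norm]
          refine (hφ2 _).trans (Finset.sum_le_sum fun i _ => ?_)
          rw [← hAv, ← ofReal_norm, ← ofReal_norm]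
          refine ENNReal.ofReal_le_ofReal ?_
          simpa [e.norm_eq_one] using norm_inner_le_norm (𝕜 := ℂ) (A (v i)) (e j)
      _ = _ := by simp
  · intro i
    calc ‖A (v i)‖ₑ ≤ ∑ j, ‖inner ℂ (A (v i)) (e j)‖ₑ := enorm_le_sum_enorm_inner _
      _ ≤ ∑ _j : Fin d, eLpNorm (fun y => U y * A) p ν := by
          refine Finset.sum_le_sum fun j _ => ?_
          rw [hAv]
          refine (hφ1 _ _).trans (eLpNorm_mono fun y => ?_)
          simpa [e.norm_eq_one] using (U y * A).le_opNorm (e j)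
      _ = _ := by simp

theorem holderConjugate_conjExp {t : ℝ} (ht : 1 < t) : t.HolderConjugate (conjExp t) :=
  Real.HolderConjugate.conjExponent ht

theorem lintegral_enorm_apply_rpow_le {α E : Type*} [MeasurableSpace α] {ν : Measure α}
    [IsProbabilityMeasure ν] [NormedAddCommGroup E] [NormedSpace ℂ E] {V U : α → E →L[ℂ] E}
    (hV : StronglyMeasurable V) (hU : StronglyMeasurable U) (hUV : ∀ x, U x * V x = 1)
    {t s : ℝ} (ht : 1 < t) (hs : 0 < s) (e : E) :
    ∫⁻ x, ‖V x e‖ₑ ^ (t * s) ∂ν ≤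
      (∫⁻ x, (∫⁻ y, ‖V x * U y‖ₑ ^ conjExp t ∂ν) ^ (s * t / conjExp t) ∂ν) *
        (∫⁻ y, ‖V y e‖ₑ ^ t ∂ν) ^ s := by
  have hp := holderConjugate_conjExp ht
  set p := conjExp t
  have ht0 : 0 < t := hp.pos
  have hVe : StronglyMeasurable fun y => V y e :=
    (ContinuousLinearMap.apply ℂ E e).continuous.comp_stronglyMeasurable hV
  have key : ∀ x, ‖V x e‖ₑ ≤
      (∫⁻ y, ‖V x * U y‖ₑ ^ p ∂ν) ^ (1 / p) * (∫⁻ y, ‖V y e‖ₑ ^ t ∂ν) ^ (1 / t) := fun x => by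
    calc ‖V x e‖ₑ = ∫⁻ _y, ‖V x e‖ₑ ∂ν := by simp
      _ ≤ ∫⁻ y, ‖V x * U y‖ₑ * ‖V y e‖ₑ ∂ν := by
        refine lintegral_mono fun y => ?_
        have h : V x e = (V x * U y) (V y e) := by
          have := congrArg (fun T : E →L[ℂ] E => V x (T e)) (hUV y)
          simpa using this.symm
        rw [h]
        exact ContinuousLinearMap.le_opENorm _ _
      _ ≤ _ := ENNReal.lintegral_mul_le_Lp_mul_Lq ν hp.symm
        (stronglyMeasurable_const.mul hU).enorm.aemeasurable hVe.enorm.aemeasurable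
  calc ∫⁻ x, ‖V x e‖ₑ ^ (t * s) ∂ν
      ≤ ∫⁻ x, (∫⁻ y, ‖V x * U y‖ₑ ^ p ∂ν) ^ (s * t / p) * (∫⁻ y, ‖V y e‖ₑ ^ t ∂ν) ^ s ∂ν := by
        refine lintegral_mono fun x =>
          (ENNReal.rpow_le_rpow (key x) (by positivity)).trans_eq ?_
        rw [ENNReal.mul_rpow_of_nonneg _ _ (by positivity), ← ENNReal.rpow_mul, ← ENNReal.rpow_mul]
        congr 2
        · ring
        · field_simp
    _ = _ := by
        refine lintegral_mul_const _ (Measurable.pow_const ?_ _)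
        exact Measurable.lintegral_prod_right' (f := fun z : α × α => ‖V z.1 * U z.2‖ₑ ^ p)
          (((hV.comp_measurable measurable_fst).mul
            (hU.comp_measurable measurable_snd)).enorm.pow_const _)

theorem lintegral_opNorm_rpow_le {α : Type*} [MeasurableSpace α] {ν : Measure α}
    [IsProbabilityMeasure ν] {d : ℕ}
    {V U : α → EuclideanSpace ℂ (Fin d) →L[ℂ] EuclideanSpace ℂ (Fin d)}
    (hV : StronglyMeasurable V) (hU : StronglyMeasurable U) (hUV : ∀ x, U x * V x = 1)
    (hVsa : ∀ x, IsSelfAdjoint (V x)) (hUsa : ∀ x, IsSelfAdjoint (U x))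
    {t s : ℝ} (ht : 1 < t) (hs : 1 < s) {R : ℝ≥0∞}
    (hR : ∀ e, ∫⁻ x, ‖V x e‖ₑ ^ t ∂ν < ⊤ →
      ∫⁻ x, ‖V x e‖ₑ ^ (t * s) ∂ν ≤ (R * ∫⁻ x, ‖V x e‖ₑ ^ t ∂ν) ^ s)
    (hfin : ∫⁻ x, (∫⁻ y, ‖V x * U y‖ₑ ^ conjExp t ∂ν) ^ (t / conjExp t) ∂ν < ⊤) :
    ∫⁻ x, (∫⁻ y, ‖V x * U y‖ₑ ^ conjExp t ∂ν) ^ (s * t / conjExp t) ∂ν ≤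
      (d : ℝ≥0∞) ^ (3 * (t * s)) *
        (R * ∫⁻ x, (∫⁻ y, ‖V x * U y‖ₑ ^ conjExp t ∂ν) ^ (t / conjExp t) ∂ν) ^ s := by
  have hp := holderConjugate_conjExp ht
  set p := conjExp t
  have hp0 : 0 < p := hp.symm.pos
  have hts : 1 ≤ t * s := by nlinarith
  have : Fact (1 ≤ ENNReal.ofReal p) := ⟨by simpa using hp.symm.lt.le⟩
  set G : α → ℝ≥0∞ := fun x => eLpNorm (fun y => V x * U y) (ENNReal.ofReal p) ν with hG
  have hGe : ∀ (x : α) (a : ℝ), (∫⁻ y, ‖V x * U y‖ₑ ^ p ∂ν) ^ (a / p) = G x ^ a := fun x a => by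
    rw [hG]
    simp only
    rw [eLpNorm_eq_lintegral_rpow_enorm_toReal (by simpa using hp0) ENNReal.ofReal_ne_top,
      ENNReal.toReal_ofReal hp0.le, ← ENNReal.rpow_mul, one_div_mul_eq_div]
  simp only [hGe] at hfin ⊢
  have hGm : Measurable G := by
    have h : Measurable fun x => (∫⁻ y, ‖V x * U y‖ₑ ^ p ∂ν) ^ (1 / p) :=
      Measurable.pow_const (Measurable.lintegral_prod_right'
        (f := fun z : α × α => ‖V z.1 * U z.2‖ₑ ^ p)
        (((hV.comp_measurable measurable_fst).mul
            (hU.comp_measurable measurable_snd)).enorm.pow_const _)) _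
    simp only [hGe, ENNReal.rpow_one] at h
    exact h
  obtain ⟨x₀, hx₀⟩ := (ae_lt_top (hGm.pow_const _) hfin.ne).exists
  have hUmem : MemLp U (ENNReal.ofReal p) ν := by
    have h1 : MemLp (fun y => V x₀ * U y) (ENNReal.ofReal p) ν :=
      ⟨(stronglyMeasurable_const.mul hU).aestronglyMeasurable,
        (ENNReal.rpow_lt_top_iff_of_pos hp.pos).1 hx₀⟩
    refine h1.of_le_mul (c := ‖U x₀‖) hU.aestronglyMeasurable
      (Filter.Eventually.of_forall fun y => ?_)
    calc ‖U y‖ = ‖U x₀ * (V x₀ * U y)‖ := by rw [← mul_assoc, hUV, one_mul]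
      _ ≤ _ := norm_mul_le _ _
  obtain ⟨r, hrd, v, hv⟩ := exists_reducing_vectors hUmem hUsa
  have hr : (r : ℝ≥0∞) ≤ d := by exact_mod_cast hrd
  have hve : ∀ i, StronglyMeasurable fun y => V y (v i) := fun i =>
    (ContinuousLinearMap.apply ℂ _ (v i)).continuous.comp_stronglyMeasurable hV
  have hlow : ∀ i, ∫⁻ x, ‖V x (v i)‖ₑ ^ t ∂ν ≤ (d : ℝ≥0∞) ^ t * ∫⁻ x, G x ^ t ∂ν := fun i => by
    rw [← lintegral_const_mul _ (hGm.pow_const _)]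
    refine lintegral_mono fun x => ?_
    simp only
    rw [← ENNReal.mul_rpow_of_nonneg _ _ hp.nonneg]
    exact ENNReal.rpow_le_rpow ((hv (V x) (hVsa x)).2 i) hp.nonneg
  have hts0 : 0 ≤ t * s := by linarith
  calc ∫⁻ x, G x ^ (s * t) ∂ν
      ≤ ∫⁻ x, (d : ℝ≥0∞) ^ (t * s) * ((r : ℝ≥0∞) ^ (t * s - 1) *
          ∑ i, ‖V x (v i)‖ₑ ^ (t * s)) ∂ν := by
        refine lintegral_mono fun x => ?_
        simp only
        rw [mul_comm s t]
        refine (ENNReal.rpow_le_rpow (hv (V x) (hVsa x)).1 hts0).trans ?_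
        rw [ENNReal.mul_rpow_of_nonneg _ _ hts0]
        gcongr
        have := ENNReal.rpow_sum_le_const_mul_sum_rpow Finset.univ (fun i => ‖V x (v i)‖ₑ) hts
        simpa using this
    _ = (d : ℝ≥0∞) ^ (t * s) * ((r : ℝ≥0∞) ^ (t * s - 1) *
          ∑ i, ∫⁻ x, ‖V x (v i)‖ₑ ^ (t * s) ∂ν) := by
        have hm : ∀ i, Measurable fun x => ‖V x (v i)‖ₑ ^ (t * s) := fun i =>
          (hve i).enorm.pow_const _
        rw [lintegral_const_mul _
            (Measurable.const_mul (Finset.measurable_fun_sum _ fun i _ => hm i) _),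
          lintegral_const_mul _ (Finset.measurable_fun_sum _ fun i _ => hm i),
          lintegral_finsetSum _ fun i _ => hm i]
    _ ≤ (d : ℝ≥0∞) ^ (t * s) * ((r : ℝ≥0∞) ^ (t * s - 1) *
          ∑ _i : Fin r, (R * ((d : ℝ≥0∞) ^ t * ∫⁻ x, G x ^ t ∂ν)) ^ s) := by
        gcongr with i
        refine (hR (v i) ((hlow i).trans_lt ?_)).trans ?_
        · exact ENNReal.mul_lt_top (ENNReal.rpow_lt_top_of_nonneg hp.nonneg (by simp)) hfin
        · exact ENNReal.rpow_le_rpow (by gcongr; exact hlow i) (by linarith)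
    _ = (d : ℝ≥0∞) ^ (t * s) * (r : ℝ≥0∞) ^ (t * s) * (d : ℝ≥0∞) ^ (t * s) *
          (R * ∫⁻ x, G x ^ t ∂ν) ^ s := by
        have h1 : (r : ℝ≥0∞) ^ (t * s - 1) * r = (r : ℝ≥0∞) ^ (t * s) := by
          conv_lhs => rw [← ENNReal.rpow_one (r : ℝ≥0∞)]
          rw [← ENNReal.rpow_mul, one_mul,
            ← ENNReal.rpow_add_of_nonneg _ _ (by linarith) zero_le_one,
            sub_add_cancel]
        rw [Finset.sum_const, Finset.card_univ, Fintype.card_fin, nsmul_eq_mul, mul_left_comm R,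
          ENNReal.mul_rpow_of_nonneg ((d : ℝ≥0∞) ^ t) _ (by linarith), ← ENNReal.rpow_mul, ← h1]
        ring
    _ ≤ (d : ℝ≥0∞) ^ (t * s) * (d : ℝ≥0∞) ^ (t * s) * (d : ℝ≥0∞) ^ (t * s) *
          (R * ∫⁻ x, G x ^ t ∂ν) ^ s := by gcongr
    _ = _ := by
        rw [← ENNReal.rpow_add_of_nonneg _ _ hts0 hts0,
          ← ENNReal.rpow_add_of_nonneg _ _ (by linarith) hts0]
        congr 2
        ring

open ProbabilityTheory in
theorem lavg_eq_lintegral_cond {α : Type*} [MeasurableSpace α] (μ : Measure α) (Q : Set α)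
    (f : α → ℝ≥0∞) : lavg μ Q f = ∫⁻ x, f x ∂cond μ Q := by
  rw [lavg, ProbabilityTheory.cond, lintegral_smul_measure, smul_eq_mul]

theorem ofReal_specNorm_mul {d : ℕ} (A B : Matrix (Fin d) (Fin d) ℂ) :
    ENNReal.ofReal (specNorm (A * B)) =
      ‖Matrix.toEuclideanCLM (𝕜 := ℂ) A * Matrix.toEuclideanCLM (𝕜 := ℂ) B‖ₑ := by
  rw [specNorm, map_mul, ofReal_norm]

open ProbabilityTheory in
theorem matApq_eq_iSup_lintegral {α : Type*} [MeasurableSpace α] {d : ℕ} {μ : Measure α}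
    {S : Set (Set α)} {W : α → Matrix (Fin d) (Fin d) ℂ}
    {V U : α → EuclideanSpace ℂ (Fin d) →L[ℂ] EuclideanSpace ℂ (Fin d)} {p q : ℝ}
    (hV : ∀ᵐ x ∂μ, Matrix.toEuclideanCLM (𝕜 := ℂ) (matRpow (W x) (1 / q)) = V x)
    (hU : ∀ᵐ x ∂μ, Matrix.toEuclideanCLM (𝕜 := ℂ) (matRpow (W x) (-(1 / q))) = U x) :
    matApq μ S W p q = ⨆ Q ∈ S, ∫⁻ x, (∫⁻ y, ‖V x * U y‖ₑ ^ conjExp p ∂cond μ Q) ^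
      (q / conjExp p) ∂cond μ Q := by
  unfold matApq
  simp only [lavg_eq_lintegral_cond, ofReal_specNorm_mul]
  refine iSup_congr fun Q => iSup_congr fun _ => ?_
  have hac : cond μ Q ≪ μ := cond_absolutelyContinuous
  refine lintegral_congr_ae ?_
  filter_upwards [hac.ae_le hV] with x hx
  rw [hx]
  congr 1
  refine lintegral_congr_ae ?_
  filter_upwards [hac.ae_le hU] with y hy
  rw [hy]

open ProbabilityTheory in
theorem matRH_eq_iSup_lintegral {α : Type*} [MeasurableSpace α] {d : ℕ} {μ : Measure α}
    {S : Set (Set α)} {W : α → Matrix (Fin d) (Fin d) ℂ}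
    {V : α → EuclideanSpace ℂ (Fin d) →L[ℂ] EuclideanSpace ℂ (Fin d)} {t : ℝ} (ht : 0 ≤ t) (s : ℝ)
    (hV : ∀ᵐ x ∂μ, Matrix.toEuclideanCLM (𝕜 := ℂ) (matRpow (W x) (1 / t)) = V x) :
    matRH μ S W t s = ⨆ (e : EuclideanSpace ℂ (Fin d)) (_ : e ≠ 0), ⨆ Q ∈ S,
      (∫⁻ x, ‖V x e‖ₑ ^ (t * s) ∂cond μ Q) ^ (1 / s) / ∫⁻ x, ‖V x e‖ₑ ^ t ∂cond μ Q := by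
  unfold matRH scalRH
  simp only [lavg_eq_lintegral_cond]
  refine iSup_congr fun e => iSup_congr fun _ => iSup_congr fun Q => iSup_congr fun _ => ?_
  have hac : cond μ Q ≪ μ := cond_absolutelyContinuous
  have h : ∀ᵐ x ∂cond μ Q,
      ENNReal.ofReal (‖Matrix.toEuclideanCLM (𝕜 := ℂ) (matRpow (W x) (1 / t)) e‖ ^ t) =
        ‖V x e‖ₑ ^ t := by
    filter_upwards [hac.ae_le hV] with x hx
    rw [hx, ← ENNReal.ofReal_rpow_of_nonneg (norm_nonneg _) ht, ofReal_norm]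
  refine congrArg₂ (fun a b : ℝ≥0∞ => a ^ (1 / s) / b) (lintegral_congr_ae ?_)
    (lintegral_congr_ae h)
  filter_upwards [h] with x hx
  rw [hx, ENNReal.rpow_mul]

theorem volume_cube {n : ℕ} (c : Fin n → ℝ) (h : ℝ) :
    volume (cube c h) = ∏ _i : Fin n, ENNReal.ofReal h := by
  have : cube c h = Set.pi Set.univ fun i => Set.Ico (c i) (c i + h) := by
    ext x
    simp [cube]
  rw [this, Real.volume_pi_Ico]
  simp

open ProbabilityTheory in
theorem isProbabilityMeasure_cond_of_mem_cubes {n : ℕ} {Q : Set (Fin n → ℝ)} (hQ : Q ∈ cubes n) :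
    IsProbabilityMeasure (cond volume Q) := by
  obtain ⟨c, h, hh, rfl⟩ := hQ
  refine cond_isProbabilityMeasure_of_finite ?_ ?_
  · rw [volume_cube]
    simp [hh]
  · rw [volume_cube]
    exact (ENNReal.prod_lt_top fun _ _ => ENNReal.ofReal_lt_top).ne

theorem enorm_toEuclideanCLM_le_sum {d : ℕ} (A : Matrix (Fin d) (Fin d) ℂ) :
    ‖Matrix.toEuclideanCLM (𝕜 := ℂ) A‖ₑ ≤ ∑ j, ∑ i, ‖A i j‖ₑ := by
  refine (enorm_clm_le_sum_enorm_apply _).trans (Finset.sum_le_sum fun j _ => ?_)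
  refine (enorm_le_sum_enorm_inner _).trans_eq (Finset.sum_congr rfl fun i _ => ?_)
  rw [← ofReal_norm, ← ofReal_norm, norm_inner_symm]
  simp [EuclideanSpace.inner_single_left, Matrix.ofLp_toEuclideanCLM]

open ProbabilityTheory in
theorem lintegral_enorm_matRpow_apply_lt_top {n d : ℕ} {W : (Fin n → ℝ) → Matrix (Fin d) (Fin d) ℂ}
    (hW : IsMatrixWeight (volume : Measure (Fin n → ℝ)) W) {t : ℝ} (ht : 1 ≤ t)
    {Q : Set (Fin n → ℝ)} (hQ : Q ∈ cubes n) (e : EuclideanSpace ℂ (Fin d)) :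
    ∫⁻ x, ‖Matrix.toEuclideanCLM (𝕜 := ℂ) (matRpow (W x) (1 / t)) e‖ₑ ^ t ∂cond volume Q < ⊤ := by
  have ht0 : 0 < t := by linarith
  have hprob := isProbabilityMeasure_cond_of_mem_cubes hQ
  obtain ⟨c, h, hh, rfl⟩ := hQ
  have hac : cond volume (cube c h) ≪ (volume : Measure (Fin n → ℝ)) := cond_absolutelyContinuous
  have hint : ∀ i j, ∫⁻ x, ‖W x i j‖ₑ ∂cond volume (cube c h) < ⊤ := fun i j => by
    have h1 : IntegrableOn (fun x => W x i j) (cube c h) volume := by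
      refine ((hW.1 i j).integrableOn_isCompact
        (isCompact_Icc (a := c) (b := fun k => c k + h))).mono_set ?_
      exact fun x hx => ⟨fun k => (hx k).1, fun k => (hx k).2.le⟩
    rw [ProbabilityTheory.cond, lintegral_smul_measure, smul_eq_mul]
    refine ENNReal.mul_lt_top (ENNReal.inv_lt_top.2 ?_) h1.2
    rw [volume_cube, pos_iff_ne_zero]
    simp [hh]
  have hm : ∀ i j, AEMeasurable (fun x => ‖W x i j‖ₑ) (cond volume (cube c h)) := fun i j =>
    ((hW.1 i j).aestronglyMeasurable.mono_ac hac).enorm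
  calc ∫⁻ x, ‖Matrix.toEuclideanCLM (𝕜 := ℂ) (matRpow (W x) (1 / t)) e‖ₑ ^ t ∂cond volume (cube c h)
      ≤ ∫⁻ x, (∑ j, ∑ i, ‖W x i j‖ₑ) * ‖e‖ₑ ^ t ∂cond volume (cube c h) := by
        refine lintegral_mono_ae ?_
        filter_upwards [hac.ae_le hW.2] with x hx
        refine (ENNReal.rpow_le_rpow (ContinuousLinearMap.le_opENorm _ e) ht0.le).trans ?_
        rw [ENNReal.mul_rpow_of_nonneg _ _ ht0.le]
        gcongr
        refine le_trans ?_ (enorm_toEuclideanCLM_le_sum (W x))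
        have h1 := specNorm_matRpow_le hx (a := 1 / t) (by positivity)
        have h2 := ENNReal.rpow_le_rpow (ENNReal.ofReal_le_ofReal h1) ht0.le
        have h3 : 0 ≤ specNorm (W x) := norm_nonneg _
        rw [← ENNReal.ofReal_rpow_of_nonneg h3 (by positivity), ← ENNReal.rpow_mul,
          one_div_mul_cancel ht0.ne', ENNReal.rpow_one] at h2
        simpa [specNorm, ofReal_norm] using h2
    _ < ⊤ := by
        rw [lintegral_mul_const'' _ (Finset.aemeasurable_fun_sum _ fun j _ =>
            Finset.aemeasurable_fun_sum _ fun i _ => hm i j),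
          lintegral_finsetSum' _ fun j _ => Finset.aemeasurable_fun_sum _ fun i _ => hm i j]
        refine ENNReal.mul_lt_top (ENNReal.sum_lt_top.2 fun j _ => ?_)
          (ENNReal.rpow_lt_top_of_nonneg ht0.le (by simp))
        rw [lintegral_finsetSum' _ fun i _ => hm i j]
        exact ENNReal.sum_lt_top.2 fun i _ => hint i j

theorem exists_stronglyMeasurable_clm {n d : ℕ} {W : (Fin n → ℝ) → Matrix (Fin d) (Fin d) ℂ}
    (hW : IsMatrixWeight (volume : Measure (Fin n → ℝ)) W) (a : ℝ) :
    ∃ V U : (Fin n → ℝ) → EuclideanSpace ℂ (Fin d) →L[ℂ] EuclideanSpace ℂ (Fin d),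
      StronglyMeasurable V ∧ StronglyMeasurable U ∧ (∀ x, U x * V x = 1) ∧
      (∀ x, IsSelfAdjoint (V x)) ∧ (∀ x, IsSelfAdjoint (U x)) ∧
      (∀ᵐ x, Matrix.toEuclideanCLM (𝕜 := ℂ) (matRpow (W x) a) = V x) ∧
      ∀ᵐ x, Matrix.toEuclideanCLM (𝕜 := ℂ) (matRpow (W x) (-a)) = U x := by
  obtain ⟨W', hm, hpos, hae⟩ :=
    exists_stronglyMeasurable_posDef (fun i j => (hW.1 i j).aestronglyMeasurable) hW.2
  have hcont : Continuous (Matrix.toEuclideanCLM (n := Fin d) (𝕜 := ℂ)) :=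
    LinearMap.continuous_of_finiteDimensional
      (Matrix.toEuclideanCLM (n := Fin d) (𝕜 := ℂ)).toAlgEquiv.toLinearMap
  refine ⟨fun x => Matrix.toEuclideanCLM (𝕜 := ℂ) (matRpow (W' x) a),
    fun x => Matrix.toEuclideanCLM (𝕜 := ℂ) (matRpow (W' x) (-a)),
    hcont.comp_stronglyMeasurable (stronglyMeasurable_matRpow hm hpos a),
    hcont.comp_stronglyMeasurable (stronglyMeasurable_matRpow hm hpos (-a)), fun x => ?_,
    fun x => (isSelfAdjoint_matRpow _ _).map _, fun x => (isSelfAdjoint_matRpow _ _).map _, ?_, ?_⟩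
  · rw [← map_mul, matRpow_neg_mul_matRpow (hpos x), map_one]
  · filter_upwards [hae] with x hx
    rw [hx]
  · filter_upwards [hae] with x hx
    rw [hx]

theorem measurable_lintegral_enorm_mul_rpow {α E : Type*} [MeasurableSpace α] {ν : Measure α}
    [SFinite ν] [NormedAddCommGroup E] [NormedSpace ℂ E] {V U : α → E →L[ℂ] E}
    (hV : StronglyMeasurable V) (hU : StronglyMeasurable U) (p a : ℝ) :
    Measurable fun x => (∫⁻ y, ‖V x * U y‖ₑ ^ p ∂ν) ^ a :=
  Measurable.pow_const (Measurable.lintegral_prod_right'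
    (f := fun z : α × α => ‖V z.1 * U z.2‖ₑ ^ p)
    (((hV.comp_measurable measurable_fst).mul
      (hU.comp_measurable measurable_snd)).enorm.pow_const _)) _

theorem enorm_apply_ne_zero {α : Type*} {d : ℕ}
    {V U : α → EuclideanSpace ℂ (Fin d) →L[ℂ] EuclideanSpace ℂ (Fin d)}
    (hUV : ∀ x, U x * V x = 1) {e : EuclideanSpace ℂ (Fin d)} (he : e ≠ 0) (x : α) :
    ‖V x e‖ₑ ≠ 0 := by
  rw [enorm_ne_zero]
  intro h
  have := congrArg (fun T : EuclideanSpace ℂ (Fin d) →L[ℂ] EuclideanSpace ℂ (Fin d) => T e) (hUV x)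
  simp [h] at this
  exact he this.symm

theorem lintegral_ne_zero_of_forall {α : Type*} [MeasurableSpace α] {ν : Measure α}
    [IsProbabilityMeasure ν] {f : α → ℝ≥0∞} (hf : Measurable f) (h : ∀ x, f x ≠ 0) :
    ∫⁻ x, f x ∂ν ≠ 0 := by
  intro h0
  obtain ⟨x, hx⟩ := ((lintegral_eq_zero_iff hf).1 h0).exists
  exact h x hx

open ProbabilityTheory in
theorem max_rpow_le_and_le_mul_rpow {n d : ℕ} {W : (Fin n → ℝ) → Matrix (Fin d) (Fin d) ℂ}
    (hW : IsMatrixWeight (volume : Measure (Fin n → ℝ)) W) {t s : ℝ} (ht : 1 < t) (hs : 1 < s) :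
    max (matApq volume (cubes n) W t t) (matRH volume (cubes n) W t s) ^ s
        ≤ matApq volume (cubes n) (fun x => matRpow (W x) s) t (s * t) ∧
      matApq volume (cubes n) (fun x => matRpow (W x) s) t (s * t)
        ≤ ((d : ℝ≥0∞) ^ (3 * (t * s)) + 1) *
          (matApq volume (cubes n) W t t * matRH volume (cubes n) W t s) ^ s := by
  have ht0 : 0 < t := by linarith
  have hs0 : 0 < s := by linarith
  have hts0 : 0 < t * s := by positivity
  obtain ⟨V, U, hV, hU, hUV, hVsa, hUsa, hVW, hUW⟩ := exists_stronglyMeasurable_clm hW (1 / t)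
  have hVW' : ∀ᵐ x, Matrix.toEuclideanCLM (𝕜 := ℂ) (matRpow (matRpow (W x) s) (1 / (s * t))) =
      V x := by
    filter_upwards [hVW, hW.2] with x hx hpos
    rw [matRpow_matRpow hpos, ← hx]
    congr 2
    field_simp
  have hUW' : ∀ᵐ x, Matrix.toEuclideanCLM (𝕜 := ℂ)
      (matRpow (matRpow (W x) s) (-(1 / (s * t)))) = U x := by
    filter_upwards [hUW, hW.2] with x hx hpos
    rw [matRpow_matRpow hpos, ← hx]
    congr 2
    field_simp
  rw [matApq_eq_iSup_lintegral hVW hUW, matApq_eq_iSup_lintegral hVW' hUW',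
    matRH_eq_iSup_lintegral ht0.le s hVW]
  set A : ℝ≥0∞ := ⨆ Q ∈ cubes n, ∫⁻ x, (∫⁻ y, ‖V x * U y‖ₑ ^ conjExp t ∂cond volume Q) ^
    (t / conjExp t) ∂cond volume Q
  set R : ℝ≥0∞ := ⨆ (e : EuclideanSpace ℂ (Fin d)) (_ : e ≠ 0), ⨆ Q ∈ cubes n,
    (∫⁻ x, ‖V x e‖ₑ ^ (t * s) ∂cond volume Q) ^ (1 / s) /
      ∫⁻ x, ‖V x e‖ₑ ^ t ∂cond volume Q
  set B : ℝ≥0∞ := ⨆ Q ∈ cubes n, ∫⁻ x, (∫⁻ y, ‖V x * U y‖ₑ ^ conjExp t ∂cond volume Q) ^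
    (s * t / conjExp t) ∂cond volume Q
  have hF : ∀ Q : Set (Fin n → ℝ), ∀ x,
      (∫⁻ y, ‖V x * U y‖ₑ ^ conjExp t ∂cond volume Q) ^ (s * t / conjExp t) =
        ((∫⁻ y, ‖V x * U y‖ₑ ^ conjExp t ∂cond volume Q) ^ (t / conjExp t)) ^ s := fun Q x => by
    rw [← ENNReal.rpow_mul]
    ring_nf
  have hVe : ∀ e, Measurable fun x => ‖V x e‖ₑ := fun e =>
    ((ContinuousLinearMap.apply ℂ _ e).continuous.comp_stronglyMeasurable hV).enorm
  have hAle : ∀ Q ∈ cubes n, ∫⁻ x, (∫⁻ y, ‖V x * U y‖ₑ ^ conjExp t ∂cond volume Q) ^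
      (t / conjExp t) ∂cond volume Q ≤ A := fun Q hQ => le_iSup₂_of_le Q hQ le_rfl
  have hBle : ∀ Q ∈ cubes n, ∫⁻ x, (∫⁻ y, ‖V x * U y‖ₑ ^ conjExp t ∂cond volume Q) ^
      (s * t / conjExp t) ∂cond volume Q ≤ B := fun Q hQ => le_iSup₂_of_le Q hQ le_rfl
  have hRle : ∀ e ≠ 0, ∀ Q ∈ cubes n, (∫⁻ x, ‖V x e‖ₑ ^ (t * s) ∂cond volume Q) ^ (1 / s) /
      ∫⁻ x, ‖V x e‖ₑ ^ t ∂cond volume Q ≤ R := fun e he Q hQ =>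
    le_iSup₂_of_le e he (le_iSup₂_of_le Q hQ le_rfl)
  have hbtop : ∀ e, ∀ Q ∈ cubes n, ∫⁻ x, ‖V x e‖ₑ ^ t ∂cond volume Q < ⊤ := fun e Q hQ => by
    refine (lintegral_congr_ae ?_).trans_lt (lintegral_enorm_matRpow_apply_lt_top hW ht.le hQ e)
    have hac : cond volume Q ≪ (volume : Measure (Fin n → ℝ)) := cond_absolutelyContinuous
    filter_upwards [hac.ae_le hVW] with x hx
    rw [hx]
  have hpos : ∀ e ≠ 0, ∀ Q ∈ cubes n, ∀ a : ℝ, 0 < a → ∫⁻ x, ‖V x e‖ₑ ^ a ∂cond volume Q ≠ 0 :=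
    fun e he Q hQ a ha => by
      have := isProbabilityMeasure_cond_of_mem_cubes hQ
      refine lintegral_ne_zero_of_forall ((hVe e).pow_const _) fun x => ?_
      simpa [ENNReal.rpow_eq_zero_iff, ha, ha.not_gt] using enorm_apply_ne_zero hUV he x
  have hAB : A ≤ B ^ (1 / s) := by
    refine iSup₂_le fun Q hQ => ?_
    have := isProbabilityMeasure_cond_of_mem_cubes hQ
    rw [one_div, ENNReal.le_rpow_inv_iff hs0]
    refine (lintegral_rpow_le_of_isProbabilityMeasure
      (measurable_lintegral_enorm_mul_rpow hV hU _ _).aemeasurable hs).trans ?_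
    simp only [← hF]
    exact hBle Q hQ
  have hRB : R ≤ B ^ (1 / s) := by
    refine iSup₂_le fun e he => iSup₂_le fun Q hQ => ENNReal.div_le_of_le_mul ?_
    have := isProbabilityMeasure_cond_of_mem_cubes hQ
    rw [one_div, ENNReal.rpow_inv_le_iff hs0, ENNReal.mul_rpow_of_nonneg _ _ hs0.le,
      ENNReal.rpow_inv_rpow hs0.ne']
    exact (lintegral_enorm_apply_rpow_le hV hU hUV ht hs0 e).trans (by gcongr; exact hBle Q hQ)
  refine ⟨?_, ?_⟩
  · rw [← ENNReal.le_rpow_inv_iff hs0, ← one_div]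
    exact max_le hAB hRB
  · refine iSup₂_le fun Q hQ => ?_
    have := isProbabilityMeasure_cond_of_mem_cubes hQ
    rcases eq_or_ne (∫⁻ x, (∫⁻ y, ‖V x * U y‖ₑ ^ conjExp t ∂cond volume Q) ^
      (t / conjExp t) ∂cond volume Q) 0 with h0 | h0
    · have : ∫⁻ x, (∫⁻ y, ‖V x * U y‖ₑ ^ conjExp t ∂cond volume Q) ^
          (s * t / conjExp t) ∂cond volume Q = 0 := by
        rw [lintegral_eq_zero_iff (measurable_lintegral_enorm_mul_rpow hV hU _ _)] at h0 ⊢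
        filter_upwards [h0] with x hx
        rw [hF, hx]
        simp [hs0]
      rw [this]
      exact zero_le
    rcases eq_or_ne A ⊤ with hAtop | hAtop
    · have : Nonempty (Fin d) := by
        by_contra hd
        rw [not_nonempty_iff] at hd
        refine h0 ?_
        have hp := (holderConjugate_conjExp ht).symm.pos
        have : ∀ x y, ‖V x * U y‖ₑ = 0 := fun x y => by
          rw [← ofReal_norm, Subsingleton.elim (V x * U y) 0, norm_zero, ENNReal.ofReal_zero]
        simp [this, hp, ht0]
      obtain ⟨i⟩ := this
      have he : EuclideanSpace.single i (1 : ℂ) ≠ 0 := by simp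
      have hR0 : R ≠ 0 := by
        refine (lt_of_lt_of_le ?_ (hRle _ he Q hQ)).ne'
        refine ENNReal.div_pos ?_ (hbtop _ Q hQ).ne
        simpa [ENNReal.rpow_eq_zero_iff, hs0, hs0.not_gt] using hpos _ he Q hQ _ hts0
      rw [hAtop, ENNReal.top_mul hR0, ENNReal.top_rpow_of_pos hs0, ENNReal.mul_top (by simp)]
      exact le_top
    · have hfin := (hAle Q hQ).trans_lt hAtop.lt_top
      refine (lintegral_opNorm_rpow_le (R := R) hV hU hUV hVsa hUsa ht hs (fun e hb => ?_)
        hfin).trans ?_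
      · rcases eq_or_ne e 0 with rfl | he
        · simp [hts0]
        · have := hRle e he Q hQ
          rwa [ENNReal.div_le_iff (hpos e he Q hQ t ht0) hb.ne, one_div,
            ENNReal.rpow_inv_le_iff hs0] at this
      · rw [mul_comm A R]
        gcongr
        · exact le_self_add
        · exact hAle Q hQ

theorem statement0 (d : ℕ) (t s : ℝ) (ht : 1 < t) (hs : 1 < s) :
    ∃ c₁ c₂ : ℝ≥0∞, 0 < c₁ ∧ c₁ < ⊤ ∧ 0 < c₂ ∧ c₂ < ⊤ ∧
      ∀ (n : ℕ) (W : (Fin n → ℝ) → Matrix (Fin d) (Fin d) ℂ),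
        IsMatrixWeight (volume : Measure (Fin n → ℝ)) W →
          max (matApq volume (cubes n) W t t) (matRH volume (cubes n) W t s) ^ s
              ≤ c₁ * matApq volume (cubes n) (fun x => matRpow (W x) s) t (s * t) ∧
            matApq volume (cubes n) (fun x => matRpow (W x) s) t (s * t)
              ≤ c₂ * (matApq volume (cubes n) W t t * matRH volume (cubes n) W t s) ^ s ∧
            ((matApq volume (cubes n) W t t < ⊤ ∧ matRH volume (cubes n) W t s < ⊤) ↔
              matApq volume (cubes n) (fun x => matRpow (W x) s) t (s * t) < ⊤) := by
  refine ⟨1, (d : ℝ≥0∞) ^ (3 * (t * s)) + 1, one_pos, ENNReal.one_lt_top, by simp, ?_, ?_⟩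
  · exact ENNReal.add_lt_top.2 ⟨ENNReal.rpow_lt_top_of_nonneg (by positivity) (by simp), by simp⟩
  intro n W hW
  obtain ⟨hmax, hmul⟩ := max_rpow_le_and_le_mul_rpow hW ht hs
  refine ⟨by rwa [one_mul], hmul, fun ⟨h1, h2⟩ => ?_, fun h => ?_⟩
  · refine hmul.trans_lt (ENNReal.mul_lt_top ?_
      (ENNReal.rpow_lt_top_of_nonneg (by linarith) (ENNReal.mul_lt_top h1 h2).ne))
    exact ENNReal.add_lt_top.2 ⟨ENNReal.rpow_lt_top_of_nonneg (by positivity) (by simp), by simp⟩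
  · exact max_lt_iff.1 ((ENNReal.rpow_lt_top_iff_of_pos (by linarith)).1 (hmax.trans_lt h))

end
end

section
/- Let W be a d×d matrix weight on ℝ^n and let 1 < p₁, q₁, p₂, q₂ < ∞ satisfy p₁ ≤ q₁, p₂ ≤ q₂, p₁ ≤ p₂ and q₂/p₂' = q₁/p₁' (where p' := p/(p−1)). Then [W]_{A_{p₁,q₁}} ≤ [W]_{A_{p₂,q₂}}. -/
open MeasureTheory ENNReal
open scoped ComplexOrder

noncomputable section

section CStarAlgebra

variable {A : Type*} [CStarAlgebra A] [PartialOrder A] [StarOrderedRing A]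

lemma CFC.smul_rpow {a : A} (ha : 0 ≤ a) {r : ℝ} (hr : 0 ≤ r) {x : ℝ} (hx : 0 ≤ x) :
    (r • a) ^ x = r ^ x • a ^ x := by
  have hcont : ∀ s : Set ℝ, ContinuousOn (fun t : ℝ => t ^ x) s := fun s =>
    (Real.continuous_rpow_const hx).continuousOn
  rw [CFC.rpow_eq_cfc_real (smul_nonneg hr ha), CFC.rpow_eq_cfc_real ha,
    ← cfc_comp_smul r (fun t : ℝ => t ^ x) a (hcont _), ← cfc_smul (r ^ x) _ a (hcont _)]
  refine cfc_congr fun t ht => ?_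
  simp only [smul_eq_mul]
  exact Real.mul_rpow hr (spectrum_nonneg_of_nonneg ha ht)

lemma star_mul_self_rpow_mul_rpow_neg (a b : A) (s : ℝ) (ha : IsStrictlyPositive a) :
    star (a ^ s * b ^ (-s)) * (a ^ s * b ^ (-s)) = b ^ (-s) * a ^ (2 * s) * b ^ (-s) := by
  rw [star_mul, (IsSelfAdjoint.of_nonneg (CFC.rpow_nonneg (a := a) (y := s))).star_eq,
    (IsSelfAdjoint.of_nonneg (CFC.rpow_nonneg (a := b) (y := -s))).star_eq, two_mul,
    CFC.rpow_add ha.isUnit]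
  simp only [mul_assoc]

lemma rpow_le_norm_sq_smul_rpow {a b : A} (ha : IsStrictlyPositive a)
    (hb : IsStrictlyPositive b) (s : ℝ) :
    a ^ (2 * s) ≤ (‖a ^ s * b ^ (-s)‖ ^ 2) • b ^ (2 * s) := by
  have h := CStarAlgebra.star_mul_le_algebraMap_norm_sq (a := a ^ s * b ^ (-s))
  rw [star_mul_self_rpow_mul_rpow_neg a b s ha] at h
  have h' := IsSelfAdjoint.conjugate_le_conjugate h
    (IsSelfAdjoint.of_nonneg (CFC.rpow_nonneg (a := b) (y := s)))
  have hl : b ^ s * (b ^ (-s) * a ^ (2 * s) * b ^ (-s)) * b ^ s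
      = (b ^ s * b ^ (-s)) * a ^ (2 * s) * (b ^ (-s) * b ^ s) := by
    simp only [mul_assoc]
  rw [hl, CFC.rpow_mul_rpow_neg s hb, CFC.rpow_neg_mul_rpow s hb, one_mul, mul_one,
    Algebra.algebraMap_eq_smul_one, mul_smul_comm, mul_one, smul_mul_assoc,
    ← CFC.rpow_add hb.isUnit, ← two_mul] at h'
  exact h'

lemma norm_rpow_mul_rpow_neg_sq_le {a b : A} (ha : IsStrictlyPositive a)
    (hb : IsStrictlyPositive b) {s r : ℝ} (hr : 0 ≤ r)
    (h : a ^ (2 * s) ≤ r • b ^ (2 * s)) : ‖a ^ s * b ^ (-s)‖ ^ 2 ≤ r := by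
  have h' := IsSelfAdjoint.conjugate_le_conjugate h
    (IsSelfAdjoint.of_nonneg (CFC.rpow_nonneg (a := b) (y := -s)))
  rw [← star_mul_self_rpow_mul_rpow_neg a b s ha, mul_smul_comm, smul_mul_assoc, two_mul s,
    CFC.rpow_add hb.isUnit, ← mul_assoc (b ^ (-s)), CFC.rpow_neg_mul_rpow s hb, one_mul,
    CFC.rpow_mul_rpow_neg s hb, ← Algebra.algebraMap_eq_smul_one,
    ← CStarAlgebra.norm_le_iff_le_algebraMap _ hr (star_mul_self_nonneg _),
    CStarRing.norm_star_mul_self, ← pow_two] at h'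
  exact h'

/-- A form of the Cordes inequality. -/
theorem norm_rpow_mul_rpow_neg_le {a b : A} (ha : IsStrictlyPositive a)
    (hb : IsStrictlyPositive b) {s t : ℝ} (hs : 0 < s) (hst : s ≤ t) :
    ‖a ^ s * b ^ (-s)‖ ≤ ‖a ^ t * b ^ (-t)‖ ^ (s / t) := by
  have ht : 0 < t := hs.trans_le hst
  have hθ : 0 ≤ s / t := by positivity
  have key := CFC.rpow_le_rpow ⟨hθ, (div_le_one ht).2 hst⟩ (rpow_le_norm_sq_smul_rpow ha hb t)
  have hexp : 2 * t * (s / t) = 2 * s := by field_simp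
  rw [CFC.smul_rpow CFC.rpow_nonneg (by positivity) hθ,
    CFC.rpow_rpow_of_exponent_nonneg _ _ _ (by positivity) hθ ha.nonneg,
    CFC.rpow_rpow_of_exponent_nonneg _ _ _ (by positivity) hθ hb.nonneg, hexp] at key
  have h := norm_rpow_mul_rpow_neg_sq_le ha hb (by positivity) key
  rw [← Real.rpow_pow_comm (norm_nonneg _)] at h
  exact (sq_le_sq₀ (norm_nonneg _) (by positivity)).1 h

end CStarAlgebra

section Matrix

open scoped MatrixOrder Matrix.Norms.L2Operator

lemma matRpow_eq_rpow {d : ℕ} {A : Matrix (Fin d) (Fin d) ℂ} (hA : A.PosDef) (a : ℝ) :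
    matRpow A a = A ^ a :=
  (CFC.rpow_eq_cfc_real hA.posSemidef.nonneg).symm

theorem specNorm_matRpow_mul_le {d : ℕ} {A B : Matrix (Fin d) (Fin d) ℂ}
    (hA : A.PosDef) (hB : B.PosDef) {s t : ℝ} (hs : 0 < s) (hst : s ≤ t) :
    specNorm (matRpow A s * matRpow B (-s)) ≤
      specNorm (matRpow A t * matRpow B (-t)) ^ (s / t) := by
  simp only [matRpow_eq_rpow hA, matRpow_eq_rpow hB]
  exact norm_rpow_mul_rpow_neg_le (Matrix.isStrictlyPositive_iff_posDef.2 hA)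
    (Matrix.isStrictlyPositive_iff_posDef.2 hB) hs hst

end Matrix

lemma lavg_mono_ae {α : Type*} [MeasurableSpace α] {μ : Measure α} {Q : Set α}
    {f g : α → ℝ≥0∞} (h : ∀ᵐ x ∂μ, f x ≤ g x) : lavg μ Q f ≤ lavg μ Q g :=
  mul_le_mul_right (lintegral_mono_ae (ae_restrict_of_ae h)) _

lemma conjExp_pos {p : ℝ} (hp : 1 < p) : 0 < conjExp p :=
  div_pos (by linarith) (by linarith)

lemma conjExp_anti {p p' : ℝ} (hp : 1 < p) (h : p ≤ p') : conjExp p' ≤ conjExp p := by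
  unfold conjExp
  rw [div_le_div_iff₀ (by linarith) (by linarith)]
  nlinarith

theorem statement2 (d n : ℕ) (W : (Fin n → ℝ) → Matrix (Fin d) (Fin d) ℂ)
    (hW : IsMatrixWeight (volume : Measure (Fin n → ℝ)) W)
    (p₁ q₁ p₂ q₂ : ℝ) (hp₁ : 1 < p₁) (hpq₁ : p₁ ≤ q₁) (hp₂ : 1 < p₂) (hpq₂ : p₂ ≤ q₂)
    (hpp : p₁ ≤ p₂) (hratio : q₂ / conjExp p₂ = q₁ / conjExp p₁) :
    matApq volume (cubes n) W p₁ q₁ ≤ matApq volume (cubes n) W p₂ q₂ := by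
  have hc₁ := conjExp_pos hp₁
  have hc₂ := conjExp_pos hp₂
  have hq₁ : 0 < q₁ := by linarith
  have hq₂ : 0 < q₂ := by linarith
  have hcross : q₂ * conjExp p₁ = q₁ * conjExp p₂ := (div_eq_div_iff hc₂.ne' hc₁.ne').1 hratio
  have hqq : q₂ ≤ q₁ := by
    refine le_of_mul_le_mul_right (hcross.trans_le ?_) hc₁
    exact mul_le_mul_of_nonneg_left (conjExp_anti hp₁ hpp) hq₁.le
  have hexp : 1 / q₁ / (1 / q₂) * conjExp p₁ = conjExp p₂ := by
    field_simp
    linarith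
  unfold matApq
  refine iSup₂_mono fun Q _ => lavg_mono_ae ?_
  filter_upwards [hW.2] with x hx
  rw [hratio]
  refine ENNReal.rpow_le_rpow (lavg_mono_ae ?_) (by positivity)
  filter_upwards [hW.2] with y hy
  have hN : ∀ M : Matrix (Fin d) (Fin d) ℂ, 0 ≤ specNorm M := fun M => norm_nonneg _
  rw [ENNReal.ofReal_rpow_of_nonneg (hN _) hc₁.le, ENNReal.ofReal_rpow_of_nonneg (hN _) hc₂.le]
  refine ENNReal.ofReal_le_ofReal ?_
  have h := Real.rpow_le_rpow (hN _) (specNorm_matRpow_mul_le hx hy (one_div_pos.2 hq₁)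
    (one_div_le_one_div_of_le hq₂ hqq)) hc₁.le
  rwa [← Real.rpow_mul (hN _), hexp] at h

end
end

section
/- Let 1 < p₁ ≤ q₁ < ∞. There exists a 2×2 matrix weight W on ℝ with [W]_{A_{p₁,q₁}} < ∞ such that [W]_{A_{p₂,q₂},𝒟} = ∞ for every choice of exponents 1 < p₂ ≤ q₂ < ∞ with p₁ < p₂ and q₂/p₂' = q₁/p₁'. -/
open MeasureTheory ENNReal
open scoped ComplexOrder

noncomputable section

/-- The real rank-one matrix `u_α u_βᵀ` with `u_θ = (cos θ, sin θ)`, viewed over `ℂ`. -/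
def rankOne (α β : ℝ) : Matrix (Fin 2) (Fin 2) ℂ :=
  !![((Real.cos α * Real.cos β : ℝ) : ℂ), ((Real.cos α * Real.sin β : ℝ) : ℂ);
     ((Real.sin α * Real.cos β : ℝ) : ℂ), ((Real.sin α * Real.sin β : ℝ) : ℂ)]

theorem rankOne_mul (α β γ δ : ℝ) :
    rankOne α β * rankOne γ δ = Real.cos (β - γ) • rankOne α δ := by
  ext i j
  fin_cases i <;> fin_cases j <;>
    simp [rankOne, Matrix.mul_apply, Fin.sum_univ_two, Real.cos_sub] <;> ring

theorem star_rankOne (α β : ℝ) : star (rankOne α β) = rankOne β α := by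
  ext i j
  fin_cases i <;> fin_cases j <;>
    simp only [rankOne, Matrix.star_apply, Fin.zero_eta, Fin.mk_one, Matrix.of_apply,
      Matrix.cons_val', Matrix.cons_val_zero, Matrix.cons_val_one, Matrix.cons_val_fin_one,
      RCLike.star_def, Complex.conj_ofReal] <;> congr 1 <;> ring

theorem rankOne_add_rankOne (α : ℝ) :
    rankOne α α + rankOne (α + Real.pi / 2) (α + Real.pi / 2) = 1 := by
  ext i j
  fin_cases i <;> fin_cases j <;>
    simp only [rankOne, Matrix.add_apply, Real.cos_add_pi_div_two, Real.sin_add_pi_div_two,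
      Fin.zero_eta, Fin.mk_one, Matrix.of_apply, Matrix.one_apply,
      Matrix.cons_val', Matrix.cons_val_zero, Matrix.cons_val_one, Matrix.cons_val_fin_one,
      ← Complex.ofReal_add]
  · have := Real.sin_sq_add_cos_sq α
    simp only [if_true]; norm_cast; nlinarith
  · simp; ring
  · simp; ring
  · have := Real.sin_sq_add_cos_sq α
    simp only [if_true]; norm_cast; nlinarith

theorem isIdempotentElem_rankOne (α : ℝ) : IsIdempotentElem (rankOne α α) := by
  simp [IsIdempotentElem, rankOne_mul]

theorem isSelfAdjoint_rankOne (α : ℝ) : IsSelfAdjoint (rankOne α α) := star_rankOne α α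

theorem rankOne_self_ne_zero (α : ℝ) : rankOne α α ≠ 0 := by
  intro h
  have h0 := congrArg Matrix.trace h
  simp only [rankOne, Matrix.trace_fin_two_of, Matrix.trace_zero] at h0
  norm_cast at h0
  nlinarith [Real.sin_sq_add_cos_sq α]

theorem specNorm_nonneg {d : ℕ} (A : Matrix (Fin d) (Fin d) ℂ) : 0 ≤ specNorm A :=
  norm_nonneg _

theorem specNorm_mul_le {d : ℕ} (A B : Matrix (Fin d) (Fin d) ℂ) :
    specNorm (A * B) ≤ specNorm A * specNorm B := by
  unfold specNorm
  rw [map_mul]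
  exact norm_mul_le _ _

theorem specNorm_add_le {d : ℕ} (A B : Matrix (Fin d) (Fin d) ℂ) :
    specNorm (A + B) ≤ specNorm A + specNorm B := by
  unfold specNorm
  rw [map_add]
  exact norm_add_le _ _

theorem specNorm_smul {d : ℕ} (c : ℝ) (A : Matrix (Fin d) (Fin d) ℂ) :
    specNorm (c • A) = |c| * specNorm A := by
  unfold specNorm
  rw [← Complex.coe_smul, map_smul, norm_smul]
  simp

theorem specNorm_mul_star {d : ℕ} (A : Matrix (Fin d) (Fin d) ℂ) :
    specNorm (A * star A) = specNorm A * specNorm A := by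
  unfold specNorm
  rw [map_mul, map_star]
  exact CStarRing.norm_self_mul_star

theorem specNorm_rankOne (α β : ℝ) : specNorm (rankOne α β) = 1 := by
  have hself : specNorm (rankOne α α) = 1 := by
    have h := specNorm_mul_star (rankOne α α)
    rw [star_rankOne, (isIdempotentElem_rankOne α).eq] at h
    have h0 : specNorm (rankOne α α) ≠ 0 := by
      unfold specNorm
      rw [norm_ne_zero_iff]
      exact (map_ne_zero_iff _ (EquivLike.injective _)).2 (rankOne_self_ne_zero α)
    exact (mul_eq_left₀ h0).1 h.symm
  have h := specNorm_mul_star (rankOne α β)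
  rw [star_rankOne, rankOne_mul, sub_self, Real.cos_zero, one_smul, hself] at h
  have h0 : 0 ≤ specNorm (rankOne α β) := specNorm_nonneg _
  nlinarith

/-- The matrix with eigenvalues `1` and `c` whose eigenvectors are the standard basis rotated
by the angle `θ`. -/
def rotDiag (θ c : ℝ) : Matrix (Fin 2) (Fin 2) ℂ :=
  rankOne θ θ + c • rankOne (θ + Real.pi / 2) (θ + Real.pi / 2)

theorem cfc_rankOne (f : ℝ → ℝ) (θ : ℝ) :
    cfc f (rankOne θ θ) =
      f 1 • rankOne θ θ + f 0 • rankOne (θ + Real.pi / 2) (θ + Real.pi / 2) := by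
  have hsa := isSelfAdjoint_rankOne θ
  have hfc : cfc f (rankOne θ θ) = cfc (fun t : ℝ => (f 1 - f 0) * t + f 0) (rankOne θ θ) := by
    refine cfc_congr fun t ht => ?_
    rcases (isIdempotentElem_rankOne θ).spectrum_subset ℝ ht with h | h
    · subst h; simp
    · rw [Set.mem_singleton_iff] at h; subst h; simp
  rw [hfc, cfc_add .., cfc_const_mul .., cfc_id' .., cfc_const ..,
    Algebra.algebraMap_eq_smul_one, ← rankOne_add_rankOne θ, smul_add, sub_smul]
  abel

theorem matRpow_rotDiag (θ c s : ℝ) : matRpow (rotDiag θ c) s = rotDiag θ (c ^ s) := by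
  have hfin : (spectrum ℝ (rankOne θ θ)).Finite :=
    (isIdempotentElem_rankOne θ).finite_spectrum ℝ
  have hW : rotDiag θ c = cfc (fun t : ℝ => t + c * (1 - t)) (rankOne θ θ) := by
    rw [cfc_rankOne]; simp [rotDiag]
  unfold matRpow
  rw [hW, ← cfc_comp' _ _ _ ((hfin.image _).continuousOn _) (hfin.continuousOn _)
    (isSelfAdjoint_rankOne θ), cfc_rankOne]
  simp [rotDiag]

theorem rotDiag_mul_rotDiag (θ φ a b : ℝ) :
    rotDiag θ a * rotDiag φ b = Real.cos (θ - φ) • rankOne θ φ +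
      (b * Real.sin (θ - φ)) • rankOne θ (φ + Real.pi / 2) +
      (-(a * Real.sin (θ - φ))) • rankOne (θ + Real.pi / 2) φ +
      (a * b * Real.cos (θ - φ)) • rankOne (θ + Real.pi / 2) (φ + Real.pi / 2) := by
  have h1 : Real.cos (θ - (φ + Real.pi / 2)) = Real.sin (θ - φ) := by
    rw [← sub_sub, Real.cos_sub_pi_div_two]
  have h2 : Real.cos (θ + Real.pi / 2 - φ) = -Real.sin (θ - φ) := by
    rw [add_sub_right_comm, Real.cos_add_pi_div_two]
  simp only [rotDiag, mul_add, add_mul, smul_mul_assoc, mul_smul_comm, rankOne_mul, h1, h2,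
    add_sub_add_right_eq_sub, smul_smul]
  module

theorem specNorm_rotDiag_mul_rotDiag_le {θ φ a b : ℝ} (ha : 0 ≤ a) (hb : 0 ≤ b) :
    specNorm (rotDiag θ a * rotDiag φ b) ≤ 1 + b * |θ - φ| + a * |θ - φ| + a * b := by
  rw [rotDiag_mul_rotDiag]
  refine (specNorm_add_le _ _).trans (add_le_add ((specNorm_add_le _ _).trans
    (add_le_add ((specNorm_add_le _ _).trans (add_le_add ?_ ?_)) ?_)) ?_) <;>
  rw [specNorm_smul, specNorm_rankOne, mul_one]
  · exact Real.abs_cos_le_one _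
  · rw [abs_mul, abs_of_nonneg hb]
    exact mul_le_mul_of_nonneg_left Real.abs_sin_le_abs hb
  · rw [abs_neg, abs_mul, abs_of_nonneg ha]
    exact mul_le_mul_of_nonneg_left Real.abs_sin_le_abs ha
  · rw [abs_mul, abs_of_nonneg (mul_nonneg ha hb)]
    exact mul_le_of_le_one_right (mul_nonneg ha hb) (Real.abs_cos_le_one _)

theorem le_specNorm_rotDiag_mul_rotDiag (θ φ a b : ℝ) :
    b * Real.sin (θ - φ) ≤ specNorm (rotDiag θ a * rotDiag φ b) := by
  have h : rankOne θ θ * (rotDiag θ a * rotDiag φ b) *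
      rankOne (φ + Real.pi / 2) (φ + Real.pi / 2) =
      (b * Real.sin (θ - φ)) • rankOne θ (φ + Real.pi / 2) := by
    simp [rotDiag_mul_rotDiag, mul_add, add_mul, rankOne_mul]
  have h3 := (specNorm_mul_le (rankOne θ θ * (rotDiag θ a * rotDiag φ b))
    (rankOne (φ + Real.pi / 2) (φ + Real.pi / 2)))
  have h4 := specNorm_mul_le (rankOne θ θ) (rotDiag θ a * rotDiag φ b)
  rw [h, specNorm_smul] at h3
  simp only [specNorm_rankOne, mul_one, one_mul] at h3 h4
  exact (le_abs_self _).trans (h3.trans h4)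

theorem posDef_rotDiag (θ : ℝ) {c : ℝ} (hc : 0 < c) : (rotDiag θ c).PosDef := by
  have hpsd (α : ℝ) : (rankOne α α).PosSemidef := by
    have h := Matrix.posSemidef_conjTranspose_mul_self (rankOne α α)
    rwa [← Matrix.star_eq_conjTranspose, star_rankOne,
      (isIdempotentElem_rankOne α).eq] at h
  have key {a b : ℝ} (A B : Matrix (Fin 2) (Fin 2) ℂ) (hA : A.PosSemidef) (hB : B.PosSemidef)
      (hAB : A + B = 1) (ha : 0 ≤ a) (hb : 0 < b) : ((a + b) • A + b • B).PosDef := by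
    have : (a + b) • A + b • B = a • A + b • (1 : Matrix (Fin 2) (Fin 2) ℂ) := by
      rw [← hAB]; module
    rw [this]
    exact Matrix.PosDef.posSemidef_add (hA.smul ha) (Matrix.PosDef.one.smul hb)
  rcases le_total c 1 with h | h
  · have := key _ _ (hpsd θ) (hpsd (θ + Real.pi / 2)) (rankOne_add_rankOne θ)
      (sub_nonneg.2 h) hc
    simpa [rotDiag] using this
  · have := key _ _ (hpsd (θ + Real.pi / 2)) (hpsd θ)
      ((add_comm _ _).trans (rankOne_add_rankOne θ)) (sub_nonneg.2 h) one_pos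
    simpa [rotDiag, add_comm] using this

theorem Continuous.rotDiag {X : Type*} [TopologicalSpace X] {f g : X → ℝ} (hf : Continuous f)
    (hg : Continuous g) : Continuous fun x => _root_.rotDiag (f x) (g x) := by
  refine continuous_matrix fun i j => ?_
  fin_cases i <;> fin_cases j <;> simp [_root_.rotDiag, rankOne] <;> fun_prop

theorem lintegral_Ico_abs_rpow_neg_half_of_nonneg {α β : ℝ} (hα : 0 ≤ α) (hαβ : α ≤ β) :
    ∫⁻ y in Set.Ico α β, ENNReal.ofReal (|y| ^ (-(1 / 2) : ℝ)) =
      ENNReal.ofReal (2 * (√β - √α)) := by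
  have hint : IntervalIntegrable (fun y : ℝ => y ^ (-(1 / 2) : ℝ)) volume α β :=
    intervalIntegral.intervalIntegrable_rpow' (by norm_num)
  rw [setLIntegral_congr Ico_ae_eq_Ioc, setLIntegral_congr_fun measurableSet_Ioc
    (g := fun y => ENNReal.ofReal (y ^ (-(1 / 2) : ℝ)))
    (fun y hy => by simp only [abs_of_pos (hα.trans_lt hy.1)]),
    ← ofReal_integral_eq_lintegral_ofReal, ← intervalIntegral.integral_of_le hαβ,
    integral_rpow (Or.inl (by norm_num))]
  · congr 1
    rw [Real.sqrt_eq_rpow, Real.sqrt_eq_rpow]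
    norm_num
    ring
  · exact (intervalIntegrable_iff_integrableOn_Ioc_of_le hαβ).1 hint
  · filter_upwards [ae_restrict_mem measurableSet_Ioc] with y hy
    exact Real.rpow_nonneg (hα.trans hy.1.le) _

theorem lintegral_Ico_abs_rpow_neg_half_of_nonpos {α β : ℝ} (hβ : β ≤ 0) (hαβ : α ≤ β) :
    ∫⁻ y in Set.Ico α β, ENNReal.ofReal (|y| ^ (-(1 / 2) : ℝ)) =
      ENNReal.ofReal (2 * (√(-α) - √(-β))) := by
  rw [← lintegral_Ico_abs_rpow_neg_half_of_nonneg (neg_nonneg.2 hβ) (neg_le_neg hαβ),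
    setLIntegral_congr (Ico_ae_eq_Ioc (a := -β)),
    ← (Measure.measurePreserving_neg (volume : Measure ℝ)).setLIntegral_comp_preimage
      measurableSet_Ioc (by fun_prop)]
  simp

/-- The `A₁` estimate for the scalar weight `|y|^(-1/2)`. -/
theorem lintegral_Ico_abs_rpow_neg_half_le {α β : ℝ} (hαβ : α < β) :
    ∫⁻ y in Set.Ico α β, ENNReal.ofReal (|y| ^ (-(1 / 2) : ℝ)) ≤
      ENNReal.ofReal (4 * (β - α) / √(max |α| |β|)) := by
  have hsq {u v : ℝ} (hu : 0 ≤ u) (huv : u < v) : 2 * (√v - √u) ≤ 4 * (v - u) / √v := by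
    have hv : 0 < √v := Real.sqrt_pos.2 (hu.trans_lt huv)
    rw [le_div_iff₀ hv]
    nlinarith [Real.sq_sqrt hu, Real.sq_sqrt (hu.trans huv.le), Real.sqrt_nonneg u,
      Real.sqrt_le_sqrt huv.le]
  rcases le_total 0 α with h | h
  · rw [lintegral_Ico_abs_rpow_neg_half_of_nonneg h hαβ.le, abs_of_nonneg h,
      abs_of_nonneg (h.trans hαβ.le), max_eq_right hαβ.le]
    exact ENNReal.ofReal_le_ofReal (hsq h hαβ)
  rcases le_total β 0 with h' | h'
  · rw [lintegral_Ico_abs_rpow_neg_half_of_nonpos h' hαβ.le, abs_of_nonpos h,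
      abs_of_nonpos h', max_eq_left (neg_le_neg hαβ.le)]
    refine ENNReal.ofReal_le_ofReal ((hsq (neg_nonneg.2 h') (neg_lt_neg hαβ)).trans_eq ?_)
    ring
  · rw [← Set.Ico_union_Ico_eq_Ico h h']
    refine (lintegral_union_le _ _ _).trans ?_
    rw [lintegral_Ico_abs_rpow_neg_half_of_nonneg le_rfl h',
      lintegral_Ico_abs_rpow_neg_half_of_nonpos le_rfl h, neg_zero, Real.sqrt_zero, sub_zero,
      sub_zero, ← ENNReal.ofReal_add (by positivity) (by positivity), abs_of_nonpos h,
      abs_of_nonneg h']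
    refine ENNReal.ofReal_le_ofReal ?_
    have hT : 0 < max (-α) β := by
      rcases h.lt_or_eq with h0 | h0
      · exact lt_max_of_lt_left (neg_pos.2 h0)
      · exact lt_max_of_lt_right (h0 ▸ hαβ)
    have h1 := Real.sqrt_le_sqrt (le_max_left (-α) β)
    have h2 := Real.sqrt_le_sqrt (le_max_right (-α) β)
    have h3 : max (-α) β ≤ β - α := max_le (by linarith) (by linarith)
    rw [le_div_iff₀ (Real.sqrt_pos.2 hT)]
    nlinarith [Real.sq_sqrt hT.le, Real.sqrt_nonneg (max (-α) β)]

/-- The function `x ↦ min(|x|, 1)^κ`. -/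
def truncAbsPow (κ x : ℝ) : ℝ := min |x| 1 ^ κ

theorem truncAbsPow_nonneg (κ x : ℝ) : 0 ≤ truncAbsPow κ x :=
  Real.rpow_nonneg (le_min (abs_nonneg _) zero_le_one) _

theorem truncAbsPow_pos (κ : ℝ) {x : ℝ} (hx : x ≠ 0) : 0 < truncAbsPow κ x :=
  Real.rpow_pos_of_pos (lt_min (abs_pos.2 hx) one_pos) _

theorem truncAbsPow_le_one {κ : ℝ} (hκ : 0 ≤ κ) (x : ℝ) : truncAbsPow κ x ≤ 1 :=
  Real.rpow_le_one (le_min (abs_nonneg _) zero_le_one) (min_le_right _ _) hκ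

theorem truncAbsPow_mono {κ : ℝ} (hκ : 0 ≤ κ) {x y : ℝ} (h : |x| ≤ |y|) :
    truncAbsPow κ x ≤ truncAbsPow κ y :=
  Real.rpow_le_rpow (le_min (abs_nonneg _) zero_le_one) (min_le_min_right _ h) hκ

theorem truncAbsPow_div_le {κ : ℝ} (hκ : 0 ≤ κ) {T y : ℝ} (hy : y ≠ 0) (hyT : |y| ≤ T) :
    truncAbsPow κ T / truncAbsPow κ y ≤ (T / |y|) ^ κ := by
  have hy0 : 0 < |y| := abs_pos.2 hy
  have hT : 0 < T := hy0.trans_le hyT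
  have hm : 0 < min |y| 1 := lt_min hy0 one_pos
  unfold truncAbsPow
  rw [← Real.div_rpow (le_min (abs_nonneg _) zero_le_one) hm.le]
  refine Real.rpow_le_rpow (div_nonneg (le_min (abs_nonneg _) zero_le_one) hm.le) ?_ hκ
  rw [div_le_div_iff₀ hm hy0, abs_of_pos hT]
  rcases le_total |y| 1 with h | h
  · rw [min_eq_left h]
    exact mul_le_mul_of_nonneg_right (min_le_left _ _) hy0.le
  · rw [min_eq_right h, min_eq_right (h.trans hyT)]
    linarith

/-- A matrix weight on `ℝ` degenerating at the origin at the rate `min(|x|, 1)^(κ q)`, in an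
eigendirection that rotates at the rate `min(|x|, 1)^κ`. -/
def rotWeight (κ q x : ℝ) : Matrix (Fin 2) (Fin 2) ℂ :=
  rotDiag (truncAbsPow κ x) (truncAbsPow κ x ^ q)

theorem isMatrixWeight_rotWeight {κ q : ℝ} (hκ : 0 < κ) (hq : 0 < q) :
    IsMatrixWeight (volume : Measure ℝ) (rotWeight κ q) := by
  have hμ : Continuous (truncAbsPow κ) :=
    (continuous_abs.min continuous_const).rpow_const fun _ => Or.inr hκ.le
  have hW : Continuous (rotWeight κ q) := by
    unfold rotWeight
    exact hμ.rotDiag (hμ.rpow_const fun _ => Or.inr hq.le)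
  refine ⟨fun i j => ?_, ?_⟩
  · have hij : Continuous fun x => rotWeight κ q x i j := hW.matrix_elem i j
    exact hij.locallyIntegrable
  have hne : ∀ᵐ x : ℝ ∂volume, x ≠ 0 := Measure.ae_ne volume 0
  filter_upwards [hne] with x hx
  exact posDef_rotDiag _ (Real.rpow_pos_of_pos (truncAbsPow_pos κ hx) _)

theorem specNorm_rotWeight_le {κ q T x y : ℝ} (hκ : 0 < κ) (hq : 0 < q) (hx : |x| ≤ T)
    (hy0 : y ≠ 0) (hy : |y| ≤ T) :
    specNorm (matRpow (rotWeight κ q x) (1 / q) * matRpow (rotWeight κ q y) (-(1 / q))) ≤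
      4 * (T / |y|) ^ κ := by
  have hT : T = |T| := (abs_of_nonneg ((abs_nonneg _).trans hx)).symm
  have hx' := truncAbsPow_mono hκ.le (hx.trans_eq hT)
  have hy' := truncAbsPow_mono hκ.le (hy.trans_eq hT)
  refine le_trans ?_ (mul_le_mul_of_nonneg_left (truncAbsPow_div_le hκ.le hy0 hy) zero_le_four)
  have hμx := truncAbsPow_nonneg κ x
  have hμy := truncAbsPow_pos κ hy0
  have hT1 := truncAbsPow_le_one hκ.le T
  have hy1 := truncAbsPow_le_one hκ.le y
  unfold rotWeight
  rw [matRpow_rotDiag, matRpow_rotDiag, Real.rpow_neg (Real.rpow_nonneg hμy.le _), one_div,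
    Real.rpow_rpow_inv hμx hq.ne', Real.rpow_rpow_inv hμy.le hq.ne']
  refine (specNorm_rotDiag_mul_rotDiag_le hμx (inv_nonneg.2 hμy.le)).trans ?_
  generalize truncAbsPow κ x = a at *
  generalize truncAbsPow κ y = b at *
  generalize truncAbsPow κ T = M at *
  have hΔ : |a - b| ≤ M := abs_sub_le_iff.2 ⟨by linarith, by linarith⟩
  have h1 : 1 ≤ M / b := (one_le_div hμy).2 hy'
  have h2 : b⁻¹ * |a - b| ≤ M / b := by
    rw [inv_mul_eq_div]; exact div_le_div_of_nonneg_right hΔ hμy.le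
  have h3 : a * |a - b| ≤ M / b := by
    have : a * |a - b| ≤ 1 * M := mul_le_mul (hx'.trans hT1) hΔ (abs_nonneg _) zero_le_one
    rw [le_div_iff₀ hμy]
    nlinarith
  have h4 : a * b⁻¹ ≤ M / b := by
    rw [← div_eq_mul_inv]; exact div_le_div_of_nonneg_right hx' hμy.le
  linarith

theorem lavg_le_of_le {α : Type*} [MeasurableSpace α] {μ : Measure α} {Q : Set α}
    (hQ : MeasurableSet Q) {f : α → ℝ≥0∞} {C : ℝ≥0∞} (h : ∀ x ∈ Q, f x ≤ C) :
    lavg μ Q f ≤ C := by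
  unfold lavg
  calc (μ Q)⁻¹ * ∫⁻ x in Q, f x ∂μ ≤ (μ Q)⁻¹ * (C * μ Q) := by
        gcongr
        rw [← setLIntegral_const]
        exact setLIntegral_mono' hQ h
    _ = C * ((μ Q)⁻¹ * μ Q) := by ring
    _ ≤ C := mul_le_of_le_one_right' (ENNReal.inv_mul_le_one _)

theorem le_lavg_of_le {α : Type*} [MeasurableSpace α] {μ : Measure α} {Q R : Set α}
    (hR : MeasurableSet R) (hRQ : R ⊆ Q) {f : α → ℝ≥0∞} {C : ℝ≥0∞} (h : ∀ x ∈ R, C ≤ f x) :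
    (μ Q)⁻¹ * μ R * C ≤ lavg μ Q f := by
  unfold lavg
  rw [mul_assoc, mul_comm (μ R), ← setLIntegral_const]
  exact mul_le_mul' le_rfl ((setLIntegral_mono' hR h).trans (lintegral_mono_set hRQ))

theorem matApq_rotWeight_lt_top {p q : ℝ} (hp : 1 < p) (hq : 0 < q) :
    matApq volume intervalsR (rotWeight (1 / (2 * conjExp p)) q) p q < ⊤ := by
  have hp' : 0 < conjExp p := div_pos (by linarith) (by linarith)
  set r := conjExp p with hr
  set κ := 1 / (2 * r) with hκ
  have hκ0 : 0 < κ := by positivity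
  have hκr : κ * r = 1 / 2 := by rw [hκ]; field_simp
  suffices h : matApq volume intervalsR (rotWeight κ q) p q ≤
      ENNReal.ofReal (4 ^ r * 4) ^ (q / r) from
    h.trans_lt (ENNReal.rpow_lt_top_of_nonneg (by positivity) ENNReal.ofReal_ne_top)
  refine iSup₂_le ?_
  rintro _ ⟨α, β, hαβ, rfl⟩
  refine lavg_le_of_le measurableSet_Ico fun x hx => ?_
  refine ENNReal.rpow_le_rpow ?_ (by positivity)
  set T := max |α| |β| with hT
  have hQT {z : ℝ} (hz : z ∈ Set.Ico α β) : |z| ≤ T := abs_le_max_abs_abs hz.1 hz.2.le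
  have hT0 : 0 < T := by
    rcases eq_or_ne α 0 with h | h
    · exact lt_max_of_lt_right (abs_pos.2 (h ▸ hαβ).ne')
    · exact lt_max_of_lt_left (abs_pos.2 h)
  rw [← hr]
  have hpt : ∀ᵐ y ∂(volume.restrict (Set.Ico α β)),
      ENNReal.ofReal (specNorm (matRpow (rotWeight κ q x) (1 / q) *
        matRpow (rotWeight κ q y) (-(1 / q)))) ^ r ≤
      ENNReal.ofReal (4 ^ r * √T) * ENNReal.ofReal (|y| ^ (-(1 / 2) : ℝ)) := by
    filter_upwards [ae_restrict_mem measurableSet_Ico,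
      ae_restrict_of_ae (Measure.ae_ne volume (0 : ℝ))] with y hy hy0
    have hy1 : 0 < |y| := abs_pos.2 hy0
    rw [ENNReal.ofReal_rpow_of_nonneg (specNorm_nonneg _) hp'.le,
      ← ENNReal.ofReal_mul (by positivity)]
    refine ENNReal.ofReal_le_ofReal ?_
    refine (Real.rpow_le_rpow (specNorm_nonneg _)
      (specNorm_rotWeight_le hκ0 hq (hQT hx) hy0 (hQT hy)) hp'.le).trans_eq ?_
    rw [Real.mul_rpow (by norm_num) (by positivity), ← Real.rpow_mul (by positivity), hκr,
      Real.div_rpow hT0.le hy1.le, Real.sqrt_eq_rpow, Real.rpow_neg hy1.le]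
    ring
  unfold lavg
  calc _ ≤ (volume (Set.Ico α β))⁻¹ * (ENNReal.ofReal (4 ^ r * √T) *
        ENNReal.ofReal (4 * (β - α) / √T)) := by
        gcongr
        refine (lintegral_mono_ae hpt).trans ?_
        rw [lintegral_const_mul' _ _ ENNReal.ofReal_ne_top]
        gcongr
        exact lintegral_Ico_abs_rpow_neg_half_le hαβ
    _ = ENNReal.ofReal (4 ^ r * 4) := by
        have hI : 0 < β - α := sub_pos.2 hαβ
        have hsT : 0 < √T := Real.sqrt_pos.2 hT0
        rw [Real.volume_Ico, ← ENNReal.ofReal_inv_of_pos hI,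
          ← ENNReal.ofReal_mul (by positivity), ← ENNReal.ofReal_mul (by positivity)]
        congr 1
        field_simp

theorem le_specNorm_rotWeight {κ q s t x y : ℝ} (hκ : 0 < κ) (hq : 0 < q) (hs : 0 < s)
    (ht : 0 < t) (ht1 : t ≤ 1) (hx : x ∈ Set.Ico (t / 2) t) (hy : y ∈ Set.Ioo 0 (t / 4)) :
    ((1 / 2 : ℝ) ^ κ - (1 / 4) ^ κ) / 2 * t ^ (-(κ * (q / s - 1))) ≤
      specNorm (matRpow (rotWeight κ q x) (1 / s) * matRpow (rotWeight κ q y) (-(1 / s))) := by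
  obtain ⟨hx1, hx2⟩ := hx
  obtain ⟨hy1, hy2⟩ := hy
  have hμx : truncAbsPow κ x = x ^ κ := by
    rw [truncAbsPow, abs_of_pos (by linarith), min_eq_left (by linarith)]
  have hμy : truncAbsPow κ y = y ^ κ := by
    rw [truncAbsPow, abs_of_pos hy1, min_eq_left (by linarith)]
  unfold rotWeight
  rw [matRpow_rotDiag, matRpow_rotDiag]
  refine le_trans ?_ (le_specNorm_rotDiag_mul_rotDiag _ _ _ _)
  have hx0 := truncAbsPow_le_one hκ.le x
  rw [hμx] at *
  rw [hμy]
  have hxt : (1 / 2) ^ κ * t ^ κ ≤ x ^ κ := by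
    rw [← Real.mul_rpow (by norm_num) ht.le]
    exact Real.rpow_le_rpow (by positivity) (by linarith) hκ.le
  have hyt : y ^ κ ≤ (1 / 4) ^ κ * t ^ κ := by
    rw [← Real.mul_rpow (by norm_num) ht.le]
    exact Real.rpow_le_rpow hy1.le (by linarith) hκ.le
  have hc : 0 < (1 / 2 : ℝ) ^ κ - (1 / 4) ^ κ :=
    sub_pos.2 (Real.rpow_lt_rpow (by norm_num) (by norm_num) hκ)
  have htκ : 0 < t ^ κ := Real.rpow_pos_of_pos ht _
  have hyκ : 0 < y ^ κ := Real.rpow_pos_of_pos hy1 _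
  have hΔ : ((1 / 2 : ℝ) ^ κ - (1 / 4) ^ κ) * t ^ κ ≤ x ^ κ - y ^ κ := by linarith
  have hΔ0 : 0 < x ^ κ - y ^ κ := (mul_pos hc htκ).trans_le hΔ
  have hsin : ((1 / 2 : ℝ) ^ κ - (1 / 4) ^ κ) / 2 * t ^ κ ≤ Real.sin (x ^ κ - y ^ κ) := by
    refine le_trans ?_ (Real.mul_le_sin hΔ0.le (by linarith [Real.pi_gt_three]))
    have h2 : (1 / 2 : ℝ) ≤ 2 / Real.pi := by
      rw [div_le_div_iff₀ two_pos Real.pi_pos]; linarith [Real.pi_le_four]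
    nlinarith [mul_le_mul_of_nonneg_right h2 hΔ0.le]
  have hb : t ^ (-(κ * (q / s))) ≤ ((y ^ κ) ^ q) ^ (-(1 / s)) := by
    rw [← Real.rpow_mul hy1.le, ← Real.rpow_mul hy1.le]
    have : κ * q * -(1 / s) = -(κ * (q / s)) := by ring
    rw [this]
    exact Real.rpow_le_rpow_of_nonpos hy1 (by linarith) (by
      rw [neg_nonpos]; positivity)
  have hsplit : t ^ (-(κ * (q / s - 1))) = t ^ (-(κ * (q / s))) * t ^ κ := by
    rw [← Real.rpow_add ht]; congr 1; ring
  rw [hsplit]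
  calc _ = t ^ (-(κ * (q / s))) * (((1 / 2 : ℝ) ^ κ - (1 / 4) ^ κ) / 2 * t ^ κ) := by ring
    _ ≤ _ := mul_le_mul hb hsin (by positivity) (by positivity)

theorem matApq_rotWeight_eq_top {κ q p s : ℝ} (hκ : 0 < κ) (hp : 1 < p) (hs : 0 < s)
    (hsq : s < q) : matApq volume dyadicsR (rotWeight κ q) p s = ⊤ := by
  have hp' : 0 < conjExp p := div_pos (by linarith) (by linarith)
  set r := conjExp p with hr
  have hδ : 0 < κ * (q / s - 1) := mul_pos hκ (sub_pos.2 ((one_lt_div hs).2 hsq))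
  set δ := κ * (q / s - 1)
  have hc : 0 < ((1 / 2 : ℝ) ^ κ - (1 / 4) ^ κ) / 2 :=
    half_pos (sub_pos.2 (Real.rpow_lt_rpow (by norm_num) (by norm_num) hκ))
  set c := ((1 / 2 : ℝ) ^ κ - (1 / 4) ^ κ) / 2 with hcdef
  have hbound (k : ℕ) : ENNReal.ofReal (1 / 2) * (ENNReal.ofReal (1 / 4) *
      ENNReal.ofReal (c * ((2 : ℝ) ^ δ) ^ k) ^ r) ^ (s / r) ≤
      matApq volume dyadicsR (rotWeight κ q) p s := by
    set t : ℝ := ((2 : ℝ) ^ k)⁻¹ with ht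
    have ht0 : 0 < t := by positivity
    have ht1 : t ≤ 1 := inv_le_one_of_one_le₀ (one_le_pow₀ one_le_two)
    have htδ : t ^ (-δ) = ((2 : ℝ) ^ δ) ^ k := by
      rw [ht, Real.inv_rpow (by positivity), Real.rpow_neg (by positivity), inv_inv,
        ← Real.rpow_natCast, ← Real.rpow_natCast, ← Real.rpow_mul zero_le_two,
        ← Real.rpow_mul zero_le_two, mul_comm]
    have hmem : Set.Ico 0 t ∈ dyadicsR := ⟨0, -k, by simp [ht]⟩
    have hratio {u v z : ℝ} (hz : 0 < z) (h : v - u = z * t) :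
        (volume (Set.Ico 0 t))⁻¹ * volume (Set.Ico u v) = ENNReal.ofReal z := by
      rw [Real.volume_Ico, Real.volume_Ico, sub_zero, ← ENNReal.ofReal_inv_of_pos ht0,
        ← ENNReal.ofReal_mul (by positivity), h]
      congr 1
      field_simp
    unfold matApq
    refine le_trans ?_ (le_iSup₂_of_le _ hmem le_rfl)
    rw [← hratio (u := t / 2) (v := t) (by norm_num) (by ring)]
    refine le_lavg_of_le measurableSet_Ico
      (Set.Ico_subset_Ico_left (by positivity)) fun x hx => ?_
    refine ENNReal.rpow_le_rpow ?_ (by positivity)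
    rw [← hratio (u := 0) (v := t / 4) (by norm_num) (by ring),
      measure_congr (Ioo_ae_eq_Ico (a := (0 : ℝ)) (b := t / 4)).symm]
    have hsub : Set.Ioo 0 (t / 4) ⊆ Set.Ico 0 t :=
      fun y hy => ⟨hy.1.le, hy.2.trans (by linarith)⟩
    refine le_lavg_of_le measurableSet_Ioo hsub fun y hy => ?_
    refine ENNReal.rpow_le_rpow (ENNReal.ofReal_le_ofReal ?_) hp'.le
    rw [← htδ]
    exact le_specNorm_rotWeight hκ (hs.trans hsq) hs ht0 ht1 hx hy
  have hlim : Filter.Tendsto (fun k : ℕ => ENNReal.ofReal (1 / 2) * (ENNReal.ofReal (1 / 4) *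
      ENNReal.ofReal (c * ((2 : ℝ) ^ δ) ^ k) ^ r) ^ (s / r)) Filter.atTop (nhds ⊤) := by
    have h1 : Filter.Tendsto (fun k : ℕ => c * ((2 : ℝ) ^ δ) ^ k) Filter.atTop Filter.atTop :=
      (tendsto_pow_atTop_atTop_of_one_lt
        (Real.one_lt_rpow one_lt_two hδ)).const_mul_atTop hc
    have h2 := ENNReal.tendsto_ofReal_atTop.comp h1
    have hmul {z : ℝ} (hz : 0 < z) {f : ℕ → ℝ≥0∞} (hf : Filter.Tendsto f Filter.atTop (nhds ⊤)) :
        Filter.Tendsto (fun k => ENNReal.ofReal z * f k) Filter.atTop (nhds ⊤) := by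
      have := ENNReal.Tendsto.const_mul (a := ENNReal.ofReal z) hf (Or.inl ENNReal.top_ne_zero)
      rwa [ENNReal.mul_top (ENNReal.ofReal_pos.2 hz).ne'] at this
    have hpow {z : ℝ} (hz : 0 < z) {f : ℕ → ℝ≥0∞} (hf : Filter.Tendsto f Filter.atTop (nhds ⊤)) :
        Filter.Tendsto (fun k => f k ^ z) Filter.atTop (nhds ⊤) := by
      have := hf.ennrpow_const z
      rwa [ENNReal.top_rpow_of_pos hz] at this
    exact hmul (by norm_num) (hpow (div_pos hs hp') (hmul (by norm_num) (hpow hp' h2)))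
  exact top_le_iff.1 (le_of_tendsto' hlim hbound)

theorem statement4 (p₁ q₁ : ℝ) (hp₁ : 1 < p₁) (hpq₁ : p₁ ≤ q₁) :
    ∃ W : ℝ → Matrix (Fin 2) (Fin 2) ℂ,
      IsMatrixWeight (volume : Measure ℝ) W ∧
      matApq volume intervalsR W p₁ q₁ < ⊤ ∧
      ∀ p₂ q₂ : ℝ, 1 < p₂ → p₂ ≤ q₂ → p₁ < p₂ →
        q₂ / conjExp p₂ = q₁ / conjExp p₁ →
        matApq volume dyadicsR W p₂ q₂ = ⊤ := by
  refine ⟨rotWeight (1 / (2 * conjExp p₁)) q₁, ?_, ?_, ?_⟩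
  · exact isMatrixWeight_rotWeight (one_div_pos.2 (mul_pos two_pos
      (div_pos (by linarith) (by linarith)))) (by linarith)
  · exact matApq_rotWeight_lt_top hp₁ (by linarith)
  · intro p₂ q₂ hp₂ hpq₂ hp h
    have h1 : 0 < conjExp p₁ := div_pos (by linarith) (by linarith)
    have h2 : 0 < conjExp p₂ := div_pos (by linarith) (by linarith)
    have hlt : conjExp p₂ < conjExp p₁ := by
      unfold conjExp
      rw [div_lt_div_iff₀ (by linarith) (by linarith)]
      linarith
    refine matApq_rotWeight_eq_top (one_div_pos.2 (mul_pos two_pos h1)) hp₂ (by linarith) ?_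
    rw [div_eq_div_iff h2.ne' h1.ne'] at h
    nlinarith

end
end
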